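/- Let A_0, ..., A_n be nonempty finite subsets of a lattice M of rank n such that the sparse resultant Res is nontrivial (not equal to ±1), and let (A_j)_{j in J} be the unique essential subfamily. Then Res = ± Elim^d with d = [L_J^sat : L_J] * MV_{M/L_J^sat}({pi(Delta_i)}_{i not in J}), where L_J^sat = (L_J tensor Q) intersect M is the saturation of L_J, pi is the projection M_R -> (M/L_J^sat) tensor R, and Delta_i = conv(A_i). -/

import Mathlib

open Pointwise MeasureTheory

noncomputable section

variable {n : ℕ}

/-- Evaluation of the character `χ^a` at a point `ξ` of the torus `(ℂˣ)^n`. -/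
def chEval (ξ : Fin n → ℂˣ) (a : Fin n → ℤ) : ℂ :=
  ∏ j, ((ξ j ^ (a j) : ℂˣ) : ℂ)

/-- `ξ` is a common root of the Laurent polynomials with supports `A i` and
coefficients `c i`. -/
def IsRootOf (A : Fin (n + 1) → Finset (Fin n → ℤ))
    (c : Fin (n + 1) → (Fin n → ℤ) → ℂ) (ξ : Fin n → ℂˣ) : Prop :=
  ∀ i, ∑ a ∈ A i, c i a * chEval ξ a = 0

/-- The family with supports `A` and coefficients `c` has a common root in the torus. -/
def HasRoot (A : Fin (n + 1) → Finset (Fin n → ℤ))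
    (c : Fin (n + 1) → (Fin n → ℤ) → ℂ) : Prop :=
  ∃ ξ, IsRootOf A c ξ

/-- Evaluation of an integer polynomial in the coefficient variables `u_{i,a}` at a
family of complex coefficients. -/
def evalCoeff (R : MvPolynomial (Fin (n + 1) × (Fin n → ℤ)) ℤ)
    (c : Fin (n + 1) → (Fin n → ℤ) → ℂ) : ℂ :=
  MvPolynomial.aeval (fun p => c p.1 p.2) R

/-- `E` is the sparse eliminant of the family of supports `A`. -/
def IsEliminant (A : Fin (n + 1) → Finset (Fin n → ℤ))
    (E : MvPolynomial (Fin (n + 1) × (Fin n → ℤ)) ℤ) : Prop :=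
  (Irreducible E ∧ {c | evalCoeff E c = 0} = closure {c | HasRoot A c})
  ∨ (E = 1 ∧ ∀ E' : MvPolynomial (Fin (n + 1) × (Fin n → ℤ)) ℤ,
      ¬ (Irreducible E' ∧ {c | evalCoeff E' c = 0} = closure {c | HasRoot A c}))

/-- `R` is the sparse resultant of the family of supports `A`: up to sign the power
`E^d` of the sparse eliminant, where `d` is the degree of the projection from the
incidence variety (the number of common roots of a generic coefficient family in the
vanishing locus). -/
def IsResultant (A : Fin (n + 1) → Finset (Fin n → ℤ))
    (R : MvPolynomial (Fin (n + 1) × (Fin n → ℤ)) ℤ) : Prop :=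
  ∃ E d, IsEliminant A E ∧ (R = E ^ d ∨ R = -E ^ d) ∧
    ∃ U : Set (Fin (n + 1) → (Fin n → ℤ) → ℂ), IsOpen U ∧
      closure (U ∩ {c | HasRoot A c}) = closure {c | HasRoot A c} ∧
      ∀ c ∈ U ∩ {c | HasRoot A c}, Nat.card {ξ // IsRootOf A c ξ} = d

/-- The partial degree of `R` in the group of variables `u_i = (u_{i,a})_a`. -/
def groupDeg (i : Fin (n + 1)) (R : MvPolynomial (Fin (n + 1) × (Fin n → ℤ)) ℤ) : ℕ :=
  R.support.sup fun m => ∑ p ∈ m.support.filter (fun p => p.1 = i), m p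

/-- Mixed volume (inclusion-exclusion formula, normalized by `MV(Q,…,Q) = k! vol Q`),
with the convention `MV = 1` for `k = 0`. -/
def mixedVolume (k : ℕ) {ι : Type*} [Fintype ι] (Q : ι → Set (Fin k → ℝ)) : ℝ :=
  if k = 0 then 1 else
    ∑ s ∈ (Finset.univ : Finset ι).powerset,
      if s.Nonempty then
        (-1 : ℝ) ^ (Fintype.card ι - s.card) * (volume (∑ i ∈ s, Q i)).toReal
      else 0

/-- The coordinatewise cast `ℤ^n → ℝ^n`. -/
def castR (n : ℕ) (x : Fin n → ℤ) : Fin n → ℝ := fun j => (x j : ℝ)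


/-- The "difference lattice" of a finite subset `A` of a lattice: the subgroup
generated by all differences of elements of `A`. -/
def diffLattice {M : Type*} [AddCommGroup M] (A : Finset M) : Submodule ℤ M :=
  Submodule.span ℤ {x | ∃ a ∈ A, ∃ b ∈ A, x = a - b}

/-- A subfamily indexed by `J` is *essential* if `#J = rank(L_J) + 1` and
`#J' ≤ rank(L_{J'})` for every proper subset `J'` of `J`. -/
def IsEssential {M : Type*} [AddCommGroup M] {κ : Type*} (A : κ → Finset M)
    (J : Finset κ) : Prop :=
  J.card = Module.finrank ℤ ↥(∑ j ∈ J, diffLattice (A j)) + 1 ∧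
  ∀ J' ⊂ J, J'.card ≤ Module.finrank ℤ ↥(∑ j ∈ J', diffLattice (A j))

/-- The relative algebraic closure in `ℂ` of the field generated by a set. -/
def algCl (S : Set ℂ) : IntermediateField (IntermediateField.adjoin ℚ S) ℂ :=
  algebraicClosure (IntermediateField.adjoin ℚ S) ℂ

lemma mem_algCl {S : Set ℂ} {a : ℂ} :
    a ∈ algCl S ↔ IsAlgebraic (IntermediateField.adjoin ℚ S) a :=
  mem_algebraicClosure_iff

lemma coe_algCl (S : Set ℂ) :
    (algCl S : Set ℂ) = (AlgebraicIndependent.matroid ℚ ℂ).closure S := by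
  rw [AlgebraicIndependent.matroid_closure_eq]
  ext a
  simp only [SetLike.mem_coe, mem_algCl, Subalgebra.mem_algebraicClosure]
  exact IntermediateField.isAlgebraic_adjoin_iff

lemma subset_algCl (S : Set ℂ) : S ⊆ algCl S := by
  rw [coe_algCl]
  exact Matroid.subset_closure _ _ (by simp)

lemma mem_algCl_of_pow {S : Set ℂ} {a : ℂ} {N : ℕ} (hN : 0 < N) (h : a ^ N ∈ algCl S) :
    a ∈ algCl S := by
  rw [mem_algCl] at *
  exact h.of_pow hN

lemma mem_algCl_of_zpow {S : Set ℂ} {a : ℂ} {N : ℤ} (hN : N ≠ 0) (h : a ^ N ∈ algCl S) :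
    a ∈ algCl S := by
  have : a ^ N.natAbs ∈ algCl S := by
    rcases Int.natAbs_eq N with h1 | h1
    · rw [h1, zpow_natCast] at h; exact h
    · rw [h1, zpow_neg, zpow_natCast] at h; simpa using inv_mem h
  exact mem_algCl_of_pow (Int.natAbs_pos.2 hN) this

/-- Steinitz exchange for algebraic independence. -/
lemma AlgebraicIndependent.card_le_of_mem_algCl {σ τ : Type*} [Fintype σ] [Fintype τ]
    {x : σ → ℂ} (hx : AlgebraicIndependent ℚ x) {s : τ → ℂ}
    (h : ∀ i, x i ∈ algCl (Set.range s)) : Fintype.card σ ≤ Fintype.card τ := by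
  have h1 : (AlgebraicIndependent.matroid ℚ ℂ).Indep (Set.range x) :=
    AlgebraicIndependent.matroid_indep_iff.2 hx.to_subtype_range
  have h2 : Set.range x ⊆ (AlgebraicIndependent.matroid ℚ ℂ).closure (Set.range s) := by
    rw [← coe_algCl]; rintro _ ⟨i, rfl⟩; exact h i
  have h3 := (AlgebraicIndependent.matroid ℚ ℂ).eRk_mono h2
  rw [Matroid.eRk_closure_eq, h1.eRk_eq_encard] at h3
  have h4 : (Set.range x).encard = Fintype.card σ := by
    rw [← Set.image_univ, hx.injective.encard_image]; simp
  have h5 : (Set.range s).encard ≤ Fintype.card τ := by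
    rw [← Set.image_univ]; refine (Set.encard_image_le _ _).trans (by simp)
  rw [h4] at h3
  exact_mod_cast h3.trans ((Matroid.eRk_le_encard _ _).trans h5)

lemma AlgebraicIndependent.of_mem_algCl {σ τ : Type*} [Fintype σ] [Fintype τ]
    {x : σ → ℂ} (hx : AlgebraicIndependent ℚ x) {s : τ → ℂ}
    (h : ∀ i, x i ∈ algCl (Set.range s)) (hc : Fintype.card τ ≤ Fintype.card σ) :
    AlgebraicIndependent ℚ s := by
  have h1 : (AlgebraicIndependent.matroid ℚ ℂ).Indep (Set.range x) :=
    AlgebraicIndependent.matroid_indep_iff.2 hx.to_subtype_range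
  have h2 : Set.range x ⊆ (AlgebraicIndependent.matroid ℚ ℂ).closure (Set.range s) := by
    rw [← coe_algCl]; rintro _ ⟨i, rfl⟩; exact h i
  have h3 := (AlgebraicIndependent.matroid ℚ ℂ).eRk_mono h2
  rw [Matroid.eRk_closure_eq, h1.eRk_eq_encard] at h3
  have h4 : (Set.range x).encard = Fintype.card σ := by
    rw [← Set.image_univ, hx.injective.encard_image]; simp
  have h5 : (Set.range s).encard ≤ Fintype.card τ := by
    rw [← Set.image_univ]; refine (Set.encard_image_le _ _).trans (by simp)
  rw [h4] at h3
  have hc' : (Fintype.card τ : ℕ∞) ≤ Fintype.card σ := by exact_mod_cast hc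
  have h6 : (Set.range s).encard = Fintype.card τ :=
    le_antisymm h5 (hc'.trans (h3.trans (Matroid.eRk_le_encard _ _)))
  have h7 : (AlgebraicIndependent.matroid ℚ ℂ).eRk (Set.range s) = (Set.range s).encard :=
    le_antisymm (Matroid.eRk_le_encard _ _) (h5.trans (hc'.trans h3))
  have h8 : (AlgebraicIndependent.matroid ℚ ℂ).Indep (Set.range s) :=
    (Matroid.indep_iff_eRk_eq_encard_of_finite (Set.finite_range s)).2 h7
  have h9 : Function.Injective s := by
    have h6' : (Set.range s).ncard = Fintype.card τ := by rw [Set.ncard, h6]; simp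
    rw [← Set.image_univ, ← Nat.card_eq_fintype_card, ← Set.ncard_univ] at h6'
    exact Set.injOn_univ.1 (Set.injOn_of_ncard_image_eq h6')
  have := AlgebraicIndependent.matroid_indep_iff.1 h8
  exact (algebraicIndependent_subtype_range h9).1 this

/-- Two algebraically independent finite families over a countable field are conjugate under an
automorphism of `ℂ`. -/
lemma exists_algEquiv_of_algebraicIndependent {K : Type} [Field K] [Algebra K ℂ] [Countable K]
    {σ : Type*} [Finite σ] {x y : σ → ℂ} (hx : AlgebraicIndependent K x)
    (hy : AlgebraicIndependent K y) : ∃ φ : ℂ ≃ₐ[K] ℂ, ∀ i, φ (x i) = y i := by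
  obtain ⟨t, hxt, ht⟩ := exists_isTranscendenceBasis_superset hx.to_subtype_range
  obtain ⟨u, hyu, hu⟩ := exists_isTranscendenceBasis_superset hy.to_subtype_range
  have hK : Cardinal.mk K ≤ Cardinal.aleph0 := Cardinal.mk_le_aleph0
  have hC : Cardinal.aleph0 < Cardinal.mk ℂ := by
    rw [Cardinal.mk_complex]; exact Cardinal.aleph0_lt_continuum
  have ht' := IsAlgClosed.cardinal_eq_cardinal_transcendence_basis_of_aleph0_lt' _ ht hK hC
  have hu' := IsAlgClosed.cardinal_eq_cardinal_transcendence_basis_of_aleph0_lt' _ hu hK hC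
  obtain ⟨e, he⟩ : ∃ e : t ≃ u, ∀ i, e ⟨x i, hxt ⟨i, rfl⟩⟩ = ⟨y i, hyu ⟨i, rfl⟩⟩ := by
    let f : (Set.range fun i => (⟨x i, hxt ⟨i, rfl⟩⟩ : t)) ↪ u :=
      ⟨fun a => ⟨y a.2.choose, hyu ⟨_, rfl⟩⟩, fun a b hab => by
        have h1 := hy.injective (congrArg Subtype.val hab)
        rw [Subtype.ext_iff, ← a.2.choose_spec, ← b.2.choose_spec, h1]⟩
    obtain ⟨g, hg⟩ := Cardinal.extend_function_of_lt f
      ((Set.finite_range _).lt_aleph0.trans (ht' ▸ hC)) (Cardinal.eq.1 (ht'.symm.trans hu'))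
    refine ⟨g, fun i => ?_⟩
    have h2 := hg ⟨_, ⟨i, rfl⟩⟩
    refine h2.trans ?_
    have h3 := (⟨_, ⟨i, rfl⟩⟩ : Set.range fun i => (⟨x i, hxt ⟨i, rfl⟩⟩ : t)).2.choose_spec
    have h4 := hx.injective (congrArg Subtype.val h3)
    exact Subtype.ext (congrArg y h4)
  let _ := IsAlgClosed.isAlgClosure_of_transcendence_basis _ ht
  let _ := IsAlgClosed.isAlgClosure_of_transcendence_basis _ hu
  let e' : Algebra.adjoin K (Set.range ((↑) : t → ℂ)) ≃ₐ[K]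
      Algebra.adjoin K (Set.range ((↑) : u → ℂ)) :=
    ht.1.aevalEquiv.symm.trans ((MvPolynomial.renameEquiv K e).trans hu.1.aevalEquiv)
  have key : ∀ a, IsAlgClosure.equivOfEquiv ℂ ℂ e'.toRingEquiv (algebraMap _ ℂ a) =
      algebraMap _ ℂ (e' a) := fun a =>
    IsAlgClosure.equivOfEquiv_algebraMap ℂ ℂ e'.toRingEquiv a
  refine ⟨AlgEquiv.ofRingEquiv (f := IsAlgClosure.equivOfEquiv ℂ ℂ e'.toRingEquiv) fun r => ?_,
    fun i => ?_⟩
  · have := key (algebraMap K _ r)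
    rw [AlgEquiv.commutes] at this
    exact this
  · have h1 : x i = algebraMap (Algebra.adjoin K (Set.range ((↑) : t → ℂ))) ℂ
        (ht.1.aevalEquiv (MvPolynomial.X ⟨x i, hxt ⟨i, rfl⟩⟩)) := by
      simp
    change IsAlgClosure.equivOfEquiv ℂ ℂ e'.toRingEquiv (x i) = _
    rw [h1, key]
    simp [e', he]

/-- An element outside `algCl S` has infinitely many conjugates over `S`. -/
lemma infinite_orbit_of_notMem_algCl {S : Set ℂ} (hS : S.Finite) {a : ℂ} (ha : a ∉ algCl S) :
    Set.Infinite {b | ∃ φ : ℂ ≃+* ℂ, (∀ s ∈ S, φ s = s) ∧ φ a = b} := by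
  have hcount : Countable (IntermediateField.adjoin ℚ S) := by
    rw [← Cardinal.mk_le_aleph0_iff]
    refine (IntermediateField.cardinalMk_adjoin_le ℚ S).trans ?_
    simp [hS.countable]
  refine Set.infinite_of_injective_forall_mem (f := fun m : ℕ => a + m)
    (fun m m' h => by simpa using h) fun m => ?_
  have h1 : AlgebraicIndependent (IntermediateField.adjoin ℚ S) (fun _ : Unit => a) := by
    rw [algebraicIndependent_unique_type_iff]; exact fun h => ha (mem_algCl.2 h)
  have h2 : AlgebraicIndependent (IntermediateField.adjoin ℚ S) (fun _ : Unit => a + m) := by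
    rw [algebraicIndependent_unique_type_iff]
    intro h
    refine ha ?_
    have : a = (a + m) - m := by ring
    rw [this]
    exact sub_mem (mem_algCl.2 h) (natCast_mem (algCl S) m)
  obtain ⟨φ, hφ⟩ := exists_algEquiv_of_algebraicIndependent h1 h2
  exact ⟨φ.toRingEquiv, fun s hs => φ.commutes
    ⟨s, IntermediateField.subset_adjoin ℚ S hs⟩, hφ ()⟩

lemma measurableSet_algebraicIndependent {σ : Type*} [Fintype σ] :
    MeasurableSet {c : σ → ℂ | AlgebraicIndependent ℚ c} := by
  have : {c : σ → ℂ | AlgebraicIndependent ℚ c} =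
      ⋂ P : {P : MvPolynomial σ ℚ // P ≠ 0}, {c | MvPolynomial.aeval c P.1 ≠ 0} := by
    ext c
    simp only [Set.mem_ofPred_eq, Set.mem_iInter, Subtype.forall, algebraicIndependent_iff]
    exact forall_congr' fun P => ⟨fun h h1 h2 => h1 (h h2), fun h h1 => by_contra fun h2 => h h2 h1⟩
  rw [this]
  have : Countable (MvPolynomial σ ℚ) := by
    rw [← Cardinal.mk_le_aleph0_iff]
    exact MvPolynomial.cardinalMk_le_max_lift.trans (by simp)
  refine MeasurableSet.iInter fun P => ?_
  have hc : Continuous fun c : σ → ℂ => MvPolynomial.aeval c P.1 := by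
    simp only [MvPolynomial.aeval_def, ← MvPolynomial.eval_map]
    exact MvPolynomial.continuous_eval _
  exact (isOpen_ne_fun hc continuous_const).measurableSet

lemma ae_algebraicIndependent_fin (m : ℕ) : ∀ᵐ c : Fin m → ℂ, AlgebraicIndependent ℚ c := by
  induction m with
  | zero =>
    refine Filter.Eventually.of_forall fun c => ?_
    rw [algebraicIndependent_empty_type_iff]
    exact (algebraMap ℚ ℂ).injective
  | succ m ih =>
    have hmp := (volume_preserving_piFinSuccAbove (fun _ : Fin (m + 1) => ℂ) 0).symm
    have hms : MeasurableSet {c : Fin (m + 1) → ℂ | AlgebraicIndependent ℚ c} :=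
      measurableSet_algebraicIndependent
    rw [← hmp.map_eq, ae_map_iff hmp.measurable.aemeasurable hms]
    have hms2 := hmp.measurable hms
    have hms3 := (MeasurableEquiv.prodComm (α := Fin m → ℂ) (β := ℂ)).measurable hms2
    rw [Measure.volume_eq_prod, ← Measure.prod_swap]
    refine (ae_map_iff measurable_swap.aemeasurable hms2).2 ?_
    refine (Measure.ae_prod_iff_ae_ae hms3).2 ?_
    filter_upwards [ih] with x hx
    have hcl : (algCl (Set.range x) : Set ℂ).Countable := by
      have : Countable (IntermediateField.adjoin ℚ (Set.range x)) := by
        rw [← Cardinal.mk_le_aleph0_iff]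
        exact (IntermediateField.cardinalMk_adjoin_le ℚ _).trans (by simp)
      exact (Algebraic.countable (IntermediateField.adjoin ℚ (Set.range x)) ℂ).mono
        fun a ha => mem_algCl.1 ha
    filter_upwards [hcl.ae_notMem volume] with a ha
    have hT : Transcendental (Algebra.adjoin ℚ (Set.range x)) a := fun h =>
      ha (mem_algCl.2 (IntermediateField.isAlgebraic_adjoin_iff.2 h))
    have h3 := (hx.option_iff_transcendental a).2 hT
    rw [← algebraicIndependent_equiv (finSuccEquiv m)] at h3
    have h4 : (MeasurableEquiv.piFinSuccAbove (fun _ : Fin (m + 1) => ℂ) 0).symm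
        (MeasurableEquiv.prodComm (x, a)) = (fun o : Option (Fin m) => o.elim a x) ∘
          finSuccEquiv m := by
      ext i
      refine Fin.cases ?_ (fun i => ?_) i <;> simp [MeasurableEquiv.piFinSuccAbove] <;> rfl
    simpa only [Set.mem_preimage, Set.mem_ofPred_eq, h4] using h3

/-- Almost every tuple of complex numbers is algebraically independent over `ℚ`. -/
lemma ae_algebraicIndependent (σ : Type*) [Fintype σ] :
    ∀ᵐ c : σ → ℂ, AlgebraicIndependent ℚ c := by
  have hmp := volume_measurePreserving_piCongrLeft (fun _ : σ => ℂ) (Fintype.equivFin σ).symm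
  rw [← hmp.map_eq, ae_map_iff hmp.measurable.aemeasurable measurableSet_algebraicIndependent]
  filter_upwards [ae_algebraicIndependent_fin (Fintype.card σ)] with c hc
  rw [← algebraicIndependent_equiv (Fintype.equivFin σ)] at hc
  convert hc using 1
  ext i
  obtain ⟨j, rfl⟩ := (Fintype.equivFin σ).symm.surjective i
  simp [MeasurableEquiv.coe_piCongrLeft, Equiv.piCongrLeft_apply_apply]

lemma exists_algebraicIndependent (σ : Type*) [Fintype σ] :
    ∃ c : σ → ℂ, AlgebraicIndependent ℚ c :=
  (ae_algebraicIndependent σ).exists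

/-- Area formula: integrating the number of preimages in `s` against a weight. -/
lemma lintegral_count_fiber_mul {E : Type*} [NormedAddCommGroup E] [NormedSpace ℝ E]
    [FiniteDimensional ℝ E] [MeasurableSpace E] [BorelSpace E] (μ : Measure E)
    [μ.IsAddHaarMeasure] {f : E → E} {f' : E → E →L[ℝ] E}
    (hf : ∀ x, HasStrictFDerivAt f (f' x) x) (hf' : Continuous f') {s : Set E}
    (hs : MeasurableSet s) (g : E → ENNReal) (hg : Measurable g) :
    ∫⁻ b, Measure.count {x ∈ s | f x = b} * g b ∂μ =
      ∫⁻ x in s, ENNReal.ofReal |(f' x).det| * g (f x) ∂μ := by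
  have hcont : Continuous f := continuous_iff_continuousAt.2 fun x => (hf x).continuousAt
  have hdet : Continuous fun x => (f' x).det :=
    ContinuousLinearMap.continuous_det.comp hf'
  set C : Set E := {x | (f' x).det = 0} with hC
  have hCm : MeasurableSet C := (isClosed_eq hdet continuous_const).measurableSet
  have hloc : ∀ x ∈ Cᶜ, ∃ U : Set E, IsOpen U ∧ x ∈ U ∧ Set.InjOn f U := by
    intro x hx
    have h1 : HasStrictFDerivAt f
        (((f' x).toContinuousLinearEquivOfDetNeZero hx : E ≃L[ℝ] E) : E →L[ℝ] E) x := by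
      simpa using hf x
    refine ⟨(h1.toOpenPartialHomeomorph f).source, (h1.toOpenPartialHomeomorph f).open_source,
      h1.mem_toOpenPartialHomeomorph_source, ?_⟩
    simpa using (h1.toOpenPartialHomeomorph f).injOn
  obtain ⟨U, hUo, hUinj, hUcov⟩ : ∃ U : ℕ → Set E, (∀ k, IsOpen (U k)) ∧
      (∀ k, Set.InjOn f (U k)) ∧ Cᶜ ⊆ ⋃ k, U k := by
    choose! V hV1 hV2 hV3 using hloc
    obtain ⟨t, htC, htc, htcov⟩ := TopologicalSpace.countable_cover_nhdsWithin
      (s := Cᶜ) (f := V) fun x hx => mem_nhdsWithin_of_mem_nhds ((hV1 x hx).mem_nhds (hV2 x hx))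
    rcases t.eq_empty_or_nonempty with rfl | hne
    · refine ⟨fun _ => ∅, by simp, by simp, ?_⟩
      simpa using htcov
    · obtain ⟨e, rfl⟩ := htc.exists_eq_range hne
      exact ⟨fun k => V (e k), fun k => hV1 _ (htC ⟨k, rfl⟩), fun k => hV3 _ (htC ⟨k, rfl⟩),
        by simpa using htcov⟩
  set W : ℕ → Set E := fun k => (s ∩ Cᶜ) ∩ disjointed U k with hW
  have hWm : ∀ k, MeasurableSet (W k) := fun k =>
    (hs.inter hCm.compl).inter (MeasurableSet.disjointed (fun k => (hUo k).measurableSet) k)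
  have hWd : Pairwise (Function.onFun Disjoint W) := fun i j hij =>
    (disjoint_disjointed U hij).mono Set.inter_subset_right Set.inter_subset_right
  have hWi : ∀ k, Set.InjOn f (W k) := fun k => (hUinj k).mono
    (Set.inter_subset_right.trans (disjointed_subset U k))
  have hWu : ⋃ k, W k = s ∩ Cᶜ := by
    rw [← Set.inter_iUnion, iUnion_disjointed]
    exact Set.inter_eq_left.2 (Set.inter_subset_right.trans hUcov)
  have hsard : μ (f '' C) = 0 := addHaar_image_eq_zero_of_det_fderivWithin_eq_zero μ
    (fun x _ => (hf x).hasFDerivAt.hasFDerivWithinAt) fun x hx => hx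
  have hfd : ∀ k, ∀ x ∈ W k, HasFDerivWithinAt f (f' x) (W k) x := fun k x _ =>
    (hf x).hasFDerivAt.hasFDerivWithinAt
  have himm : ∀ k, MeasurableSet (f '' W k) := fun k =>
    measurable_image_of_fderivWithin (hWm k) (hfd k) (hWi k)
  have hcount : ∀ b ∉ f '' C, Measure.count {x ∈ s | f x = b} =
      ∑' k, (f '' W k).indicator (fun _ => (1 : ENNReal)) b := by
    intro b hb
    have h1 : {x ∈ s | f x = b} = ⋃ k, (W k ∩ f ⁻¹' {b}) := by
      rw [← Set.iUnion_inter, hWu]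
      ext x
      simp only [Set.mem_ofPred_eq, Set.mem_inter_iff, Set.mem_preimage, Set.mem_singleton_iff]
      exact ⟨fun h => ⟨⟨h.1, fun hx => hb ⟨x, hx, h.2⟩⟩, h.2⟩, fun h => ⟨h.1.1, h.2⟩⟩
    have hbm : MeasurableSet (f ⁻¹' {b}) := hcont.measurable (measurableSet_singleton b)
    rw [h1, measure_iUnion (fun i j hij => (hWd hij).mono Set.inter_subset_left
      Set.inter_subset_left) fun k => (hWm k).inter hbm]
    refine tsum_congr fun k => ?_
    by_cases hk : b ∈ f '' W k
    · rw [Set.indicator_of_mem hk]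
      obtain ⟨x, hx, rfl⟩ := hk
      have : W k ∩ f ⁻¹' {f x} = {x} := by
        ext y
        simp only [Set.mem_inter_iff, Set.mem_preimage, Set.mem_singleton_iff]
        exact ⟨fun h => hWi k h.1 hx h.2, by rintro rfl; exact ⟨hx, rfl⟩⟩
      rw [this, Measure.count_singleton]
    · rw [Set.indicator_of_notMem hk]
      have : W k ∩ f ⁻¹' {b} = ∅ := by
        ext y
        simp only [Set.mem_inter_iff, Set.mem_preimage, Set.mem_singleton_iff,
          Set.mem_empty_iff_false, iff_false]
        exact fun h => hk ⟨y, h⟩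
      rw [this, measure_empty]
  calc ∫⁻ b, Measure.count {x ∈ s | f x = b} * g b ∂μ
      = ∫⁻ b, ∑' k, (f '' W k).indicator g b ∂μ := by
        refine lintegral_congr_ae ?_
        filter_upwards [measure_eq_zero_iff_ae_notMem.1 hsard] with b hb
        rw [hcount b hb, ← ENNReal.tsum_mul_right]
        refine tsum_congr fun k => ?_
        by_cases hk : b ∈ f '' W k <;> simp [hk]
    _ = ∑' k, ∫⁻ x in W k, ENNReal.ofReal |(f' x).det| * g (f x) ∂μ := by
        rw [lintegral_tsum fun k => (hg.indicator (himm k)).aemeasurable]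
        refine tsum_congr fun k => ?_
        rw [lintegral_indicator (himm k),
          lintegral_image_eq_lintegral_abs_det_fderiv_mul μ (hWm k) (hfd k) (hWi k)]
    _ = ∫⁻ x in s ∩ Cᶜ, ENNReal.ofReal |(f' x).det| * g (f x) ∂μ := by
        rw [← hWu, lintegral_iUnion hWm hWd]
    _ = ∫⁻ x in s, ENNReal.ofReal |(f' x).det| * g (f x) ∂μ := by
        rw [← lintegral_inter_add_sdiff (fun x => ENNReal.ofReal |(f' x).det| * g (f x)) s
            hCm.compl,
          Set.sdiff_compl, setLIntegral_congr_fun (s := s ∩ C) (g := 0) (hs.inter hCm)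
            (fun x hx => by simp [show (f' x).det = 0 from hx.2])]
        simp

section Gaussian

open ComplexConjugate

/-- The unnormalized Gaussian density on `ℂ`, as a complex number. -/
def cGauss (z : ℂ) : ℂ := (Real.exp (-‖z‖ ^ 2) : ℂ)

lemma continuous_cGauss : Continuous cGauss := by
  unfold cGauss; fun_prop

lemma integrable_exp_neg_norm_sq : Integrable fun z : ℂ => Real.exp (-‖z‖ ^ 2) := by
  refine not_imp_comm.1 integral_undef ?_
  have h := Complex.integral_exp_neg_rpow (p := 2) (by norm_num)
  simp only [Real.rpow_two] at h
  rw [h]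
  norm_num

lemma integral_norm_sq_mul_exp_neg_norm_sq :
    ∫ z : ℂ, ‖z‖ ^ 2 * Real.exp (-‖z‖ ^ 2) = Real.pi := by
  have h := Complex.integral_rpow_mul_exp_neg_rpow (p := 2) (q := 2) (by norm_num) (by norm_num)
  simp only [Real.rpow_two] at h
  rw [h]
  norm_num

lemma integrable_norm_sq_mul_exp_neg_norm_sq :
    Integrable fun z : ℂ => ‖z‖ ^ 2 * Real.exp (-‖z‖ ^ 2) := by
  refine not_imp_comm.1 integral_undef ?_
  rw [integral_norm_sq_mul_exp_neg_norm_sq]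
  positivity

lemma integrable_cGauss : Integrable cGauss := integrable_exp_neg_norm_sq.ofReal

lemma integral_cGauss : ∫ z, cGauss z = Real.pi := by
  have h := Complex.integral_exp_neg_rpow (p := 2) (by norm_num)
  simp only [Real.rpow_two] at h
  unfold cGauss
  rw [integral_complex_ofReal, h]
  norm_num

lemma integrable_mul_cGauss : Integrable fun z : ℂ => z * cGauss z := by
  refine Integrable.mono' (integrable_exp_neg_norm_sq.add integrable_norm_sq_mul_exp_neg_norm_sq)
    (continuous_id.mul continuous_cGauss).aestronglyMeasurable
    (Filter.Eventually.of_forall fun z => ?_)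
  simp only [cGauss, Pi.add_apply, norm_mul, Complex.norm_real, Real.norm_eq_abs, Real.abs_exp]
  nlinarith [Real.exp_pos (-‖z‖ ^ 2), sq_nonneg (‖z‖ - 1),
    mul_nonneg (Real.exp_pos (-‖z‖ ^ 2)).le (sq_nonneg (‖z‖ - 1)),
    mul_nonneg (Real.exp_pos (-‖z‖ ^ 2)).le (sq_nonneg ‖z‖)]

lemma integral_mul_cGauss : ∫ z : ℂ, z * cGauss z = 0 := by
  have h := integral_neg_eq_self (fun z : ℂ => z * cGauss z) volume
  simp only [cGauss, norm_neg, neg_mul, integral_neg] at h ⊢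
  exact self_eq_neg.1 h.symm

lemma integrable_conj_mul_cGauss : Integrable fun z : ℂ => conj z * cGauss z := by
  refine integrable_mul_cGauss.congr' ?_ (Filter.Eventually.of_forall fun z => ?_)
  · exact (Complex.continuous_conj.mul continuous_cGauss).aestronglyMeasurable
  · simp

lemma mul_conj_mul_cGauss (z : ℂ) :
    z * conj z * cGauss z = ((‖z‖ ^ 2 * Real.exp (-‖z‖ ^ 2) : ℝ) : ℂ) := by
  rw [Complex.mul_conj, Complex.normSq_eq_norm_sq]
  simp [cGauss]

lemma integrable_mul_conj_mul_cGauss : Integrable fun z : ℂ => z * conj z * cGauss z := by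
  simp_rw [mul_conj_mul_cGauss]
  exact integrable_norm_sq_mul_exp_neg_norm_sq.ofReal

lemma integral_mul_conj_mul_cGauss : ∫ z : ℂ, z * conj z * cGauss z = Real.pi := by
  simp_rw [mul_conj_mul_cGauss]
  rw [integral_complex_ofReal, integral_norm_sq_mul_exp_neg_norm_sq]

/-- The coordinate factor of `w a * conj (w b)` times the Gaussian density. -/
def gaussFactor {κ : Type*} [DecidableEq κ] (a b i : κ) (z : ℂ) : ℂ :=
  (if i = a then z else 1) * (if i = b then conj z else 1) * cGauss z

lemma integrable_gaussFactor {κ : Type*} [DecidableEq κ] (a b i : κ) :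
    Integrable (gaussFactor a b i) := by
  unfold gaussFactor
  split_ifs <;> simp -failIfUnchanged only [one_mul, mul_one]
  · exact integrable_mul_conj_mul_cGauss
  · exact integrable_mul_cGauss
  · exact integrable_conj_mul_cGauss
  · exact integrable_cGauss

variable {κ : Type*} [Fintype κ] [DecidableEq κ]

lemma prod_gaussFactor (a b : κ) (w : κ → ℂ) :
    ∏ i, gaussFactor a b i (w i) = w a * conj (w b) * ∏ i, cGauss (w i) := by
  simp only [gaussFactor, Finset.prod_mul_distrib]
  simp

lemma integrable_mul_conj_prod_cGauss (a b : κ) :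
    Integrable fun w : κ → ℂ => w a * conj (w b) * ∏ i, cGauss (w i) := by
  simp_rw [← prod_gaussFactor]
  exact Integrable.fintype_prod fun i => integrable_gaussFactor a b i

lemma integral_mul_conj_prod_cGauss (a b : κ) :
    ∫ w : κ → ℂ, w a * conj (w b) * ∏ i, cGauss (w i) =
      if a = b then (Real.pi : ℂ) ^ Fintype.card κ else 0 := by
  simp_rw [← prod_gaussFactor]
  rw [integral_fintype_prod_volume_eq_prod (fun i => gaussFactor a b i)]
  split_ifs with hab
  · subst hab
    rw [Finset.prod_congr rfl (g := fun _ => (Real.pi : ℂ)), Finset.prod_const, Finset.card_univ]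
    intro i _
    by_cases h : i = a
    · simp only [gaussFactor, h, if_true, integral_mul_conj_mul_cGauss]
    · simp only [gaussFactor, h, if_false, one_mul, integral_cGauss]
  · refine Finset.prod_eq_zero (Finset.mem_univ a) ?_
    simp only [gaussFactor, if_true, hab, if_false, mul_one, integral_mul_cGauss]

lemma integrable_linear_mul_conj_prod_cGauss (α β : κ → ℂ) :
    Integrable fun w : κ → ℂ =>
      (∑ a, α a * w a) * conj (∑ a, β a * w a) * ∏ i, cGauss (w i) := by
  have : (fun w : κ → ℂ => (∑ a, α a * w a) * conj (∑ a, β a * w a) * ∏ i, cGauss (w i)) =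
      fun w => ∑ a, ∑ b, (α a * conj (β b)) * (w a * conj (w b) * ∏ i, cGauss (w i)) := by
    ext w
    rw [map_sum, Finset.sum_mul_sum, Finset.sum_mul]
    simp only [Finset.sum_mul, map_mul]
    refine Finset.sum_congr rfl fun a _ => Finset.sum_congr rfl fun b _ => by ring
  rw [this]
  exact integrable_finsetSum _ fun a _ => integrable_finsetSum _ fun b _ =>
    (integrable_mul_conj_prod_cGauss a b).const_mul _

lemma integral_linear_mul_conj_prod_cGauss (α β : κ → ℂ) :
    ∫ w : κ → ℂ, (∑ a, α a * w a) * conj (∑ a, β a * w a) * ∏ i, cGauss (w i) =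
      (Real.pi : ℂ) ^ Fintype.card κ * ∑ a, α a * conj (β a) := by
  have : (fun w : κ → ℂ => (∑ a, α a * w a) * conj (∑ a, β a * w a) * ∏ i, cGauss (w i)) =
      fun w => ∑ a, ∑ b, (α a * conj (β b)) * (w a * conj (w b) * ∏ i, cGauss (w i)) := by
    ext w
    rw [map_sum, Finset.sum_mul_sum, Finset.sum_mul]
    simp only [Finset.sum_mul, map_mul]
    refine Finset.sum_congr rfl fun a _ => Finset.sum_congr rfl fun b _ => by ring
  rw [this, integral_finsetSum _ fun a _ => integrable_finsetSum _ fun b _ =>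
    (integrable_mul_conj_prod_cGauss a b).const_mul _, Finset.mul_sum]
  refine Finset.sum_congr rfl fun a _ => ?_
  rw [integral_finsetSum _ fun b _ => (integrable_mul_conj_prod_cGauss a b).const_mul _]
  simp_rw [integral_const_mul, integral_mul_conj_prod_cGauss]
  simp [mul_comm]

end Gaussian

section Gaussian

open ComplexConjugate

variable {κ : Type*} [Fintype κ]

/-- The rank one perturbation `w ↦ w - t (v ⬝ w) conj v` of the identity of `ℂ^κ`. -/
def rankOnePerturb (v : κ → ℂ) (t : ℂ) : (κ → ℂ) →ₗ[ℂ] (κ → ℂ) :=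
  LinearMap.id - (∑ i, v i • LinearMap.proj i : (κ → ℂ) →ₗ[ℂ] ℂ).smulRight (t • fun i => conj (v i))

lemma rankOnePerturb_apply (v : κ → ℂ) (t : ℂ) (w : κ → ℂ) (i : κ) :
    rankOnePerturb v t w i = w i - t * (∑ j, v j * w j) * conj (v i) := by
  simp [rankOnePerturb]
  ring

lemma det_rankOnePerturb [DecidableEq κ] (v : κ → ℂ) (t : ℂ) :
    LinearMap.det (rankOnePerturb v t) = 1 - t * ∑ i, v i * conj (v i) := by
  have : LinearMap.toMatrix' (rankOnePerturb v t) =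
      1 + Matrix.replicateCol Unit (fun i => -t * conj (v i)) * Matrix.replicateRow Unit v := by
    ext i j
    rw [LinearMap.toMatrix'_apply, rankOnePerturb_apply]
    simp [Matrix.one_apply, Pi.single_apply, Matrix.mul_apply]
    ring
  rw [← LinearMap.det_toMatrix', this, Matrix.det_one_add_replicateCol_mul_replicateRow,
    dotProduct, Finset.mul_sum, sub_eq_add_neg, ← Finset.sum_neg_distrib]
  exact congrArg _ (Finset.sum_congr rfl fun i _ => by ring)

lemma sum_mul_rankOnePerturb (v : κ → ℂ) (t : ℂ) (α w : κ → ℂ) :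
    ∑ i, α i * rankOnePerturb v t w i =
      ∑ i, (α i - t * (∑ j, α j * conj (v j)) * v i) * w i := by
  simp only [rankOnePerturb_apply, mul_sub, sub_mul, Finset.sum_sub_distrib]
  congr 1
  calc ∑ i, α i * (t * (∑ j, v j * w j) * conj (v i))
      = t * (∑ i, α i * conj (v i)) * (∑ j, v j * w j) := by
        rw [Finset.mul_sum Finset.univ (fun i => α i * conj (v i)), Finset.sum_mul]
        exact Finset.sum_congr rfl fun i _ => by ring
    _ = _ := by
        rw [Finset.mul_sum]
        exact Finset.sum_congr rfl fun i _ => by ring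

lemma prod_cGauss (w : κ → ℂ) :
    ∏ i, cGauss (w i) = Complex.exp (-∑ i, w i * conj (w i)) := by
  rw [← Finset.sum_neg_distrib, Complex.exp_sum]
  refine Finset.prod_congr rfl fun i _ => ?_
  rw [cGauss, Complex.mul_conj, Complex.normSq_eq_norm_sq]
  push_cast
  rfl

lemma cGauss_eq (z : ℂ) : cGauss z = Complex.exp (-(z * conj z)) := by
  rw [cGauss, Complex.mul_conj, Complex.normSq_eq_norm_sq]
  push_cast
  rfl

/-- The parameter for which `rankOnePerturb` diagonalizes the perturbed Gaussian. -/
lemma exists_gauss_parameter (V : ℝ) (hV : 0 ≤ V) :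
    ∃ t : ℝ, (1 - t * V) ^ 2 = 1 / (1 + V) ∧ t ^ 2 * V - 2 * t = -1 / (1 + V) := by
  set s := √(1 + V) with hs
  have h1 : s ^ 2 = 1 + V := Real.sq_sqrt (by linarith)
  have h0 : 0 < s := Real.sqrt_pos.2 (by linarith)
  have hV' : V = s ^ 2 - 1 := by linarith
  refine ⟨1 / (s * (s + 1)), ?_, ?_⟩
  · rw [← h1, hV']
    field_simp
    ring
  · rw [← h1, hV']
    field_simp
    ring

lemma prod_cGauss_rankOnePerturb (v : κ → ℂ) (t : ℝ)
    (h1 : (1 - t * ∑ i, ‖v i‖ ^ 2) ^ 2 = 1 / (1 + ∑ i, ‖v i‖ ^ 2))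
    (h2 : t ^ 2 * (∑ i, ‖v i‖ ^ 2) - 2 * t = -1 / (1 + ∑ i, ‖v i‖ ^ 2)) (w : κ → ℂ) :
    (∏ i, cGauss (rankOnePerturb v t w i)) * cGauss (∑ i, v i * rankOnePerturb v t w i) =
      ∏ i, cGauss (w i) := by
  set V := ∑ i, ‖v i‖ ^ 2 with hVdef
  have hV : ((V : ℝ) : ℂ) = ∑ j, v j * conj (v j) := by
    rw [hVdef]
    push_cast
    refine Finset.sum_congr rfl fun i _ => ?_
    rw [Complex.mul_conj, Complex.normSq_eq_norm_sq]
    push_cast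
    rfl
  rw [prod_cGauss, prod_cGauss, cGauss_eq, ← Complex.exp_add]
  congr 1
  set S := ∑ j, v j * w j with hS
  have e1 : ∑ i, v i * rankOnePerturb v t w i = (1 - t * V) * S := by
    rw [sum_mul_rankOnePerturb, ← hV, hS, Finset.mul_sum]
    exact Finset.sum_congr rfl fun i _ => by ring
  have hSc : ∑ j, conj (v j) * conj (w j) = conj S := by simp [hS]
  have e2 : ∑ i, rankOnePerturb v t w i * conj (rankOnePerturb v t w i) =
      (∑ i, w i * conj (w i)) + (t ^ 2 * V - 2 * t) * (S * conj S) := by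
    have : ∀ i, rankOnePerturb v t w i * conj (rankOnePerturb v t w i) = w i * conj (w i)
        - t * S * (conj (v i) * conj (w i)) - t * conj S * (v i * w i)
        + t ^ 2 * (S * conj S) * (v i * conj (v i)) := by
      intro i
      simp only [rankOnePerturb_apply, ← hS, map_sub, map_mul, Complex.conj_ofReal,
        Complex.conj_conj]
      ring
    simp only [this, Finset.sum_add_distrib, Finset.sum_sub_distrib, ← Finset.mul_sum, hSc, ← hS,
      ← hV]
    ring
  have h3 : ((1 - t * V) ^ 2 + (t ^ 2 * V - 2 * t) : ℂ) = 0 := by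
    have : (1 - t * V) ^ 2 + (t ^ 2 * V - 2 * t) = 0 := by rw [h1, h2]; ring
    exact_mod_cast this
  rw [e1, e2]
  simp only [map_mul, map_sub, map_one, Complex.conj_ofReal]
  linear_combination (-(S * conj S)) * h3

lemma integrable_linear_mul_conj_gauss (v α β : κ → ℂ) :
    Integrable fun c : κ → ℂ => (∑ a, α a * c a) * conj (∑ a, β a * c a) *
      ((∏ i, cGauss (c i)) * cGauss (∑ a, v a * c a)) := by
  classical
  have hc : Continuous fun c : κ → ℂ => cGauss (∑ a, v a * c a) :=
    continuous_cGauss.comp (by fun_prop)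
  refine ((integrable_linear_mul_conj_prod_cGauss α β).bdd_mul hc.aestronglyMeasurable
    (c := 1) (Filter.Eventually.of_forall fun c => ?_)).congr
    (Filter.Eventually.of_forall fun c => ?_)
  · simp only [cGauss, Complex.norm_real, Real.norm_eq_abs, Real.abs_exp, Real.exp_le_one_iff,
      Left.neg_nonpos_iff]
    positivity
  · simp only
    ring

lemma integral_linear_mul_conj_gauss (v α β : κ → ℂ) :
    ∫ c : κ → ℂ, (∑ a, α a * c a) * conj (∑ a, β a * c a) *
      ((∏ i, cGauss (c i)) * cGauss (∑ a, v a * c a)) =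
    (Real.pi : ℂ) ^ Fintype.card κ *
      ((∑ a, α a * conj (β a)) / (1 + ∑ a, v a * conj (v a)) -
        (∑ a, α a * conj (v a)) * (∑ a, v a * conj (β a)) / (1 + ∑ a, v a * conj (v a)) ^ 2) := by
  classical
  set V := ∑ i, ‖v i‖ ^ 2 with hVdef
  have hV0 : 0 ≤ V := Finset.sum_nonneg fun i _ => by positivity
  have hV : ((V : ℝ) : ℂ) = ∑ j, v j * conj (v j) := by
    rw [hVdef]
    push_cast
    refine Finset.sum_congr rfl fun i _ => ?_
    rw [Complex.mul_conj, Complex.normSq_eq_norm_sq]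
    push_cast
    rfl
  obtain ⟨t, h1, h2⟩ := exists_gauss_parameter V hV0
  set P := rankOnePerturb v t with hP
  have hdetP : LinearMap.det P = ((1 - t * V : ℝ) : ℂ) := by
    rw [hP, det_rankOnePerturb, ← hV]
    push_cast
    rfl
  have hdet : LinearMap.det (P.restrictScalars ℝ) = 1 / (1 + V) := by
    rw [LinearMap.det_restrictScalars, hdetP, Algebra.norm_complex_apply, Complex.normSq_ofReal,
      ← h1]
    ring
  have hne : LinearMap.det (P.restrictScalars ℝ) ≠ 0 := by
    rw [hdet]; positivity
  have hbij : Function.Bijective P := by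
    have := ((LinearMap.equivOfDetNeZero _ hne)).bijective
    exact this
  set G : (κ → ℂ) → ℂ := fun c => (∑ a, α a * c a) * conj (∑ a, β a * c a) *
      ((∏ i, cGauss (c i)) * cGauss (∑ a, v a * c a)) with hG
  have hcv := integral_image_eq_integral_abs_det_fderiv_smul volume (s := Set.univ)
    (f := P) (f' := fun _ => (P.restrictScalars ℝ).toContinuousLinearMap) MeasurableSet.univ
    (fun x _ => ((P.restrictScalars ℝ).toContinuousLinearMap.hasFDerivAt).hasFDerivWithinAt)
    hbij.1.injOn G
  rw [Set.image_univ, hbij.2.range_eq, Measure.restrict_univ] at hcv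
  rw [hcv]
  have hdet' : |((P.restrictScalars ℝ).toContinuousLinearMap).det| = 1 / (1 + V) := by
    rw [ContinuousLinearMap.det, LinearMap.coe_toContinuousLinearMap, hdet,
      abs_of_nonneg (by positivity)]
  simp only [hdet']
  rw [integral_smul]
  have hGP : ∀ w, G (P w) = (∑ i, (α i - t * (∑ j, α j * conj (v j)) * v i) * w i) *
      conj (∑ i, (β i - t * (∑ j, β j * conj (v j)) * v i) * w i) * ∏ i, cGauss (w i) := by
    intro w
    rw [hG]
    simp only [hP]
    rw [prod_cGauss_rankOnePerturb v t h1 h2 w, sum_mul_rankOnePerturb, sum_mul_rankOnePerturb]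
  simp only [hGP]
  rw [integral_linear_mul_conj_prod_cGauss]
  set X := ∑ j, α j * conj (v j) with hX
  have hY : conj (∑ j, β j * conj (v j)) = ∑ a, v a * conj (β a) := by
    simp [mul_comm]
  set Y := ∑ j, β j * conj (v j) with hYd
  have e : ∑ a, (α a - t * X * v a) * conj (β a - t * Y * v a) =
      ∑ a, α a * conj (β a) + (t ^ 2 * V - 2 * t) * (X * conj Y) := by
    have : ∀ a, (α a - t * X * v a) * conj (β a - t * Y * v a) = α a * conj (β a)
        - t * conj Y * (α a * conj (v a)) - t * X * (v a * conj (β a))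
        + t ^ 2 * (X * conj Y) * (v a * conj (v a)) := by
      intro a
      simp only [map_sub, map_mul, Complex.conj_ofReal]
      ring
    simp only [this, Finset.sum_add_distrib, Finset.sum_sub_distrib, ← Finset.mul_sum, ← hX, ← hV,
      ← hY]
    ring
  have h2' : ((t : ℂ) ^ 2 * V - 2 * t) = -1 / (1 + V) := by exact_mod_cast h2
  have hne' : (1 + V : ℂ) ≠ 0 := by
    have : (1 + V : ℝ) ≠ 0 := by positivity
    exact_mod_cast this
  rw [e, h2', ← hV, ← hY, Complex.real_smul]
  push_cast
  field_simp
  ring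

end Gaussian

section ExpSystem

open ComplexConjugate

variable {r : ℕ} {K : Fin r → Type} (e : ∀ i, K i → Fin r → ℝ)

/-- The exponential monomial `exp ⟨e i k, z⟩`. -/
def expMon (i : Fin r) (k : K i) (z : Fin r → ℂ) : ℂ := Complex.exp (∑ j, (e i k j : ℂ) * z j)

lemma continuous_expMon (i : Fin r) (k : K i) : Continuous (expMon e i k) := by
  unfold expMon; fun_prop

lemma expMon_mul_conj (i : Fin r) (k : K i) (z : Fin r → ℂ) :
    expMon e i k z * conj (expMon e i k z) =
      ((Real.exp (2 * ∑ m, e i k m * (z m).re) : ℝ) : ℂ) := by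
  rw [expMon, Complex.mul_conj, Complex.normSq_eq_norm_sq, Complex.norm_exp, ← Real.exp_nat_mul]
  congr 3
  simp

variable [∀ i, Fintype (K i)]

/-- The exponential sums `-∑ k, c i k exp ⟨e i k, z⟩`. -/
def expSys (c : ∀ i, K i → ℂ) (z : Fin r → ℂ) (i : Fin r) : ℂ :=
  -∑ k, expMon e i k z * c i k

/-- The Jacobian matrix of `expSys`. -/
def expJac (c : ∀ i, K i → ℂ) (z : Fin r → ℂ) : Matrix (Fin r) (Fin r) ℂ :=
  Matrix.of fun i j => -∑ k, (e i k j * expMon e i k z) * c i k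

lemma hasStrictFDerivAt_expSys (c : ∀ i, K i → ℂ) (z : Fin r → ℂ) :
    HasStrictFDerivAt (expSys e c) (Matrix.toLin' (expJac e c z)).toContinuousLinearMap z := by
  rw [hasStrictFDerivAt_pi']
  intro i
  have h1 : ∀ k : K i, HasStrictFDerivAt (fun z : Fin r → ℂ => ∑ j, (e i k j : ℂ) * z j)
      (∑ j, (e i k j : ℂ) • ContinuousLinearMap.proj (R := ℂ) (φ := fun _ : Fin r => ℂ) j) z := by
    intro k
    exact HasStrictFDerivAt.fun_sum fun j _ =>
      ((ContinuousLinearMap.proj (R := ℂ) (φ := fun _ : Fin r => ℂ) j).hasStrictFDerivAt).const_mul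
        (e i k j : ℂ)
  have h2 := (HasStrictFDerivAt.fun_sum (u := Finset.univ) fun k _ =>
    ((h1 k).cexp.mul_const (c i k))).neg
  refine h2.congr_fderiv ?_
  ext y
  simp only [neg_apply, sum_apply,
    smul_apply, ContinuousLinearMap.proj_apply, smul_eq_mul,
    ContinuousLinearMap.comp_apply, LinearMap.coe_toContinuousLinearMap', Matrix.toLin'_apply,
    Matrix.mulVec, dotProduct, expJac, Matrix.of_apply, neg_mul, Finset.sum_neg_distrib, neg_inj,
    Finset.sum_mul, Finset.mul_sum]
  rw [Finset.sum_comm]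
  refine Finset.sum_congr rfl fun j _ => Finset.sum_congr rfl fun k _ => ?_
  rw [expMon]
  ring

lemma continuous_expJac (c : ∀ i, K i → ℂ) : Continuous (expJac e c) := by
  refine continuous_matrix fun i j => ?_
  have := continuous_expMon e i
  simp only [expJac, Matrix.of_apply]
  fun_prop

lemma lintegral_count_expSys (c : ∀ i, K i → ℂ) {s : Set (Fin r → ℂ)} (hs : MeasurableSet s)
    (g : (Fin r → ℂ) → ENNReal) (hg : Measurable g) :
    ∫⁻ b, Measure.count {z ∈ s | expSys e c z = b} * g b =
      ∫⁻ z in s, ENNReal.ofReal (‖(expJac e c z).det‖ ^ 2) * g (expSys e c z) := by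
  rw [lintegral_count_fiber_mul volume (f := expSys e c)
    (f' := fun z => (Matrix.toLin' (expJac e c z)).toContinuousLinearMap.restrictScalars ℝ)
    (fun z => (hasStrictFDerivAt_expSys e c z).restrictScalars ℝ) ?_ hs g hg]
  · refine lintegral_congr fun z => ?_
    congr 2
    have : ((Matrix.toLin' (expJac e c z)).toContinuousLinearMap.restrictScalars ℝ).det =
        LinearMap.det ((Matrix.toLin' (expJac e c z)).restrictScalars ℝ) := rfl
    rw [this, LinearMap.det_restrictScalars, LinearMap.det_toLin', Algebra.norm_complex_apply,
      Complex.normSq_eq_norm_sq, abs_of_nonneg (by positivity)]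
  · rw [continuous_clm_apply]
    intro y
    have := continuous_expJac e c
    simp only [ContinuousLinearMap.coe_restrictScalars', LinearMap.coe_toContinuousLinearMap',
      Matrix.toLin'_apply]
    exact this.matrix_mulVec continuous_const

/-- The covariance matrix of the Gibbs measure on `{0} ∪ {e i k}` at the point `x`. -/
def covMat (i : Fin r) (x : Fin r → ℝ) : Matrix (Fin r) (Fin r) ℝ := Matrix.of fun j l =>
  (∑ k, e i k j * e i k l * Real.exp (2 * ∑ m, e i k m * x m)) /
      (1 + ∑ k, Real.exp (2 * ∑ m, e i k m * x m)) -
    (∑ k, e i k j * Real.exp (2 * ∑ m, e i k m * x m)) *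
      (∑ k, e i k l * Real.exp (2 * ∑ m, e i k m * x m)) /
      (1 + ∑ k, Real.exp (2 * ∑ m, e i k m * x m)) ^ 2

/-- The unnormalized mixed discriminant. -/
def mixedDisc {r : ℕ} (C : Fin r → Matrix (Fin r) (Fin r) ℝ) : ℝ :=
  ∑ σ : Equiv.Perm (Fin r), ∑ τ : Equiv.Perm (Fin r),
    ((Equiv.Perm.sign σ : ℤ) : ℝ) * ((Equiv.Perm.sign τ : ℤ) : ℝ) * ∏ i, C i (σ i) (τ i)

/-- The integrand in the Kac-Rice formula. -/
def kacRice (c : ∀ i, K i → ℂ) (z : Fin r → ℂ) : ℝ :=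
  ‖(expJac e c z).det‖ ^ 2 * (∏ i, Real.exp (-‖expSys e c z i‖ ^ 2)) *
    ∏ i, ∏ k, Real.exp (-‖c i k‖ ^ 2)

lemma kacRice_eq (c : ∀ i, K i → ℂ) (z : Fin r → ℂ) :
    ((kacRice e c z : ℝ) : ℂ) = ∑ σ : Equiv.Perm (Fin r), ∑ τ : Equiv.Perm (Fin r),
      ((Equiv.Perm.sign σ : ℤ) : ℂ) * ((Equiv.Perm.sign τ : ℤ) : ℂ) *
      ∏ i, ((∑ k, (e i k (σ i) * expMon e i k z) * c i k) *
        conj (∑ k, (e i k (τ i) * expMon e i k z) * c i k) *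
        ((∏ k, cGauss (c i k)) * cGauss (∑ k, expMon e i k z * c i k))) := by
  have h1 : ((kacRice e c z : ℝ) : ℂ) = (expJac e c z).det * conj (expJac e c z).det *
      ∏ i, ((∏ k, cGauss (c i k)) * cGauss (∑ k, expMon e i k z * c i k)) := by
    rw [kacRice, Complex.mul_conj, Complex.normSq_eq_norm_sq, Finset.prod_mul_distrib]
    simp only [expSys, norm_neg, cGauss]
    push_cast
    ring
  have h2 : (expJac e c z).det = ∑ σ : Equiv.Perm (Fin r), ((Equiv.Perm.sign σ : ℤ) : ℂ) *
      ∏ i, -(∑ k, (e i k (σ i) * expMon e i k z) * c i k) := by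
    rw [← Matrix.det_transpose, Matrix.det_apply']
    rfl
  rw [h1, h2, map_sum, Finset.sum_mul_sum, Finset.sum_mul]
  refine Finset.sum_congr rfl fun σ _ => ?_
  rw [Finset.sum_mul]
  refine Finset.sum_congr rfl fun τ _ => ?_
  rw [map_mul, map_prod]
  simp only [map_neg, Finset.prod_neg, Finset.prod_mul_distrib]
  have h3 : ((-1 : ℂ) ^ (Finset.univ : Finset (Fin r)).card) *
      ((-1 : ℂ) ^ (Finset.univ : Finset (Fin r)).card) = 1 := by
    rw [← mul_pow]; simp
  simp only [map_intCast]
  linear_combination (((Equiv.Perm.sign σ : ℤ) : ℂ) * ((Equiv.Perm.sign τ : ℤ) : ℂ) *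
      ((∏ i, (∑ k, (e i k (σ i) * expMon e i k z) * c i k)) *
        (∏ i, conj (∑ k, (e i k (τ i) * expMon e i k z) * c i k))) *
        ((∏ i, ∏ k, cGauss (c i k)) * ∏ i, cGauss (∑ k, expMon e i k z * c i k))) * h3

lemma integrable_kacRice (z : Fin r → ℂ) : Integrable fun c => kacRice e c z := by
  have : Integrable fun c => ((kacRice e c z : ℝ) : ℂ) := by
    simp_rw [kacRice_eq]
    refine integrable_finsetSum _ fun σ _ => integrable_finsetSum _ fun τ _ => ?_
    refine Integrable.const_mul ?_ _
    refine Integrable.fintype_prod_dep (μ := fun _ => volume) (f := fun i (d : K i → ℂ) =>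
      ((∑ k, (e i k (σ i) * expMon e i k z) * d k) *
        conj (∑ k, (e i k (τ i) * expMon e i k z) * d k) *
        ((∏ k, cGauss (d k)) * cGauss (∑ k, expMon e i k z * d k))))
      fun i => integrable_linear_mul_conj_gauss (fun k => expMon e i k z)
        (fun k => e i k (σ i) * expMon e i k z) (fun k => e i k (τ i) * expMon e i k z)
  exact this.re

lemma integral_kacRice (z : Fin r → ℂ) :
    ∫ c, kacRice e c z = Real.pi ^ (∑ i, Fintype.card (K i)) *
      mixedDisc fun i => covMat e i fun j => (z j).re := by
  apply Complex.ofReal_injective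
  rw [← integral_complex_ofReal]
  simp_rw [kacRice_eq]
  have hintegrable : ∀ σ τ : Equiv.Perm (Fin r), Integrable fun c : ∀ i, K i → ℂ =>
      ((Equiv.Perm.sign σ : ℤ) : ℂ) * ((Equiv.Perm.sign τ : ℤ) : ℂ) *
      ∏ i, ((∑ k, (e i k (σ i) * expMon e i k z) * c i k) *
        conj (∑ k, (e i k (τ i) * expMon e i k z) * c i k) *
        ((∏ k, cGauss (c i k)) * cGauss (∑ k, expMon e i k z * c i k))) := by
    intro σ τ
    refine Integrable.const_mul ?_ _
    refine Integrable.fintype_prod_dep (μ := fun _ => volume) (f := fun i (d : K i → ℂ) =>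
      ((∑ k, (e i k (σ i) * expMon e i k z) * d k) *
        conj (∑ k, (e i k (τ i) * expMon e i k z) * d k) *
        ((∏ k, cGauss (d k)) * cGauss (∑ k, expMon e i k z * d k))))
      fun i => integrable_linear_mul_conj_gauss (fun k => expMon e i k z)
        (fun k => e i k (σ i) * expMon e i k z) (fun k => e i k (τ i) * expMon e i k z)
  rw [integral_finsetSum _ fun σ _ => integrable_finsetSum _ fun τ _ => hintegrable σ τ, mixedDisc]
  push_cast
  rw [Finset.mul_sum]
  refine Finset.sum_congr rfl fun σ _ => ?_
  rw [integral_finsetSum _ fun τ _ => hintegrable σ τ, Finset.mul_sum]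
  refine Finset.sum_congr rfl fun τ _ => ?_
  rw [integral_const_mul, integral_fintype_prod_volume_eq_prod (fun i (d : K i → ℂ) =>
      ((∑ k, (e i k (σ i) * expMon e i k z) * d k) *
        conj (∑ k, (e i k (τ i) * expMon e i k z) * d k) *
        ((∏ k, cGauss (d k)) * cGauss (∑ k, expMon e i k z * d k))))]
  rw [← Finset.prod_pow_eq_pow_sum, mul_left_comm, ← Finset.prod_mul_distrib]
  congr 1
  refine Finset.prod_congr rfl fun i _ => ?_
  rw [integral_linear_mul_conj_gauss]
  congr 1
  have e1 : ∀ k, expMon e i k z * conj (expMon e i k z) =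
      ((Real.exp (2 * ∑ m, e i k m * (z m).re) : ℝ) : ℂ) := fun k => expMon_mul_conj e i k z
  have e2 : ∀ k, (e i k (σ i) * expMon e i k z) * conj (e i k (τ i) * expMon e i k z) =
      ((e i k (σ i) * e i k (τ i) * Real.exp (2 * ∑ m, e i k m * (z m).re) : ℝ) : ℂ) := by
    intro k
    rw [map_mul, Complex.conj_ofReal]
    push_cast [← e1]
    ring
  have e3 : ∀ k, (e i k (σ i) * expMon e i k z) * conj (expMon e i k z) =
      ((e i k (σ i) * Real.exp (2 * ∑ m, e i k m * (z m).re) : ℝ) : ℂ) := by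
    intro k
    rw [mul_assoc, e1]
    push_cast
    rfl
  have e4 : ∀ k, expMon e i k z * conj (e i k (τ i) * expMon e i k z) =
      ((e i k (τ i) * Real.exp (2 * ∑ m, e i k m * (z m).re) : ℝ) : ℂ) := by
    intro k
    rw [map_mul, Complex.conj_ofReal, mul_left_comm, e1]
    push_cast
    rfl
  simp only [e1, e2, e3, e4, covMat, Matrix.of_apply]
  push_cast
  rfl

end ExpSystem

lemma volume_preserving_piCurry_symm {ι : Type*} [Fintype ι] {K : ι → Type*} [∀ i, Fintype (K i)]
    {X : Type*} [MeasureSpace X] [SigmaFinite (volume : Measure X)] :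
    MeasurePreserving (MeasurableEquiv.piCurry (fun (i : ι) (_ : K i) => X)).symm := by
  refine ⟨(MeasurableEquiv.piCurry _).symm.measurable, ?_⟩
  symm
  refine Measure.pi_eq fun s hs => ?_
  have : (MeasurableEquiv.piCurry (fun (i : ι) (_ : K i) => X)).symm ⁻¹' Set.univ.pi s =
      Set.univ.pi fun i => Set.univ.pi fun k => s ⟨i, k⟩ := by
    ext c
    simp [Set.mem_pi, MeasurableEquiv.coe_piCurry_symm, Sigma.uncurry, Sigma.forall]
  rw [MeasurableEquiv.map_apply, this, volume_pi_pi, Fintype.prod_sigma]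
  simp [volume_pi_pi]

section ExpSystem

variable {r : ℕ} {K : Fin r → Type} [∀ i, Fintype (K i)] (e : ∀ i, K i → Fin r → ℝ)

lemma ae_ae_algebraicIndependent (r : ℕ) (K : Fin r → Type) [∀ i, Fintype (K i)] :
    ∀ᵐ c : ∀ i, K i → ℂ, ∀ᵐ b : Fin r → ℂ,
      AlgebraicIndependent ℚ (Sum.elim (fun p : Σ i, K i => c p.1 p.2) b) := by
  have h1 := (volume_measurePreserving_sumPiEquivProdPi_symm
    (fun _ : (Σ i, K i) ⊕ Fin r => ℂ)).comp
    ((volume_preserving_piCurry_symm (K := K) (X := ℂ)).prod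
      (MeasurePreserving.id (volume : Measure (Fin r → ℂ))))
  have h2 := h1.quasiMeasurePreserving.ae (ae_algebraicIndependent ((Σ i, K i) ⊕ Fin r))
  refine (Measure.ae_ae_of_ae_prod h2).mono fun c hc => hc.mono fun b hb => ?_
  convert hb using 1
  ext (x | x) <;> rfl

/-- The fundamental strip for the exponential map to the torus. -/
def expStrip (r : ℕ) : Set (Fin r → ℂ) := {z | ∀ j, (z j).im ∈ Set.Ioc (-Real.pi) Real.pi}

lemma measurableSet_expStrip (r : ℕ) : MeasurableSet (expStrip r) := by
  have : expStrip r = ⋂ j, (fun z : Fin r → ℂ => (z j).im) ⁻¹' Set.Ioc (-Real.pi) Real.pi := by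
    ext z; simp [expStrip]
  rw [this]
  exact MeasurableSet.iInter fun j =>
    (Complex.measurable_im.comp (measurable_pi_apply j)) measurableSet_Ioc

lemma lintegral_expStrip (r : ℕ) (h : (Fin r → ℝ) → ENNReal) (hh : Measurable h) :
    ∫⁻ z in expStrip r, h (fun j => (z j).re) =
      ENNReal.ofReal ((2 * Real.pi) ^ r) * ∫⁻ x, h x := by
  have hmp := (volume_measurePreserving_arrowProdEquivProdArrow ℝ ℝ (Fin r)).comp
    (volume_preserving_pi (fun _ : Fin r => Complex.volume_preserving_equiv_real_prod))
  set Box : Set (Fin r → ℝ) := Set.univ.pi fun _ => Set.Ioc (-Real.pi) Real.pi with hBox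
  have hBm : MeasurableSet Box := MeasurableSet.univ_pi fun _ => measurableSet_Ioc
  have hvol : volume Box = ENNReal.ofReal ((2 * Real.pi) ^ r) := by
    rw [hBox, volume_pi_pi]
    simp only [Real.volume_Ioc, Finset.prod_const, Finset.card_univ, Fintype.card_fin]
    rw [← ENNReal.ofReal_pow (by linarith [Real.pi_pos])]
    congr 2
    ring
  have h1 : ∫⁻ z in expStrip r, h (fun j => (z j).re) =
      ∫⁻ p : (Fin r → ℝ) × (Fin r → ℝ), h p.1 * Box.indicator 1 p.2 := by
    have hm : Measurable fun p : (Fin r → ℝ) × (Fin r → ℝ) => h p.1 * Box.indicator 1 p.2 :=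
      (hh.comp measurable_fst).mul ((measurable_one.indicator hBm).comp measurable_snd)
    rw [← hmp.lintegral_comp hm, ← lintegral_indicator (measurableSet_expStrip r)]
    refine lintegral_congr fun z => ?_
    by_cases hz : z ∈ expStrip r
    · rw [Set.indicator_of_mem hz]
      have : (fun j => (z j).im) ∈ Box := fun j _ => hz j
      have h2 := Set.indicator_of_mem this (1 : (Fin r → ℝ) → ENNReal)
      change _ = h (fun j => (z j).re) * Box.indicator 1 (fun j => (z j).im)
      rw [h2]; simp
    · rw [Set.indicator_of_notMem hz]
      have : (fun j => (z j).im) ∉ Box := fun h => hz fun j => h j trivial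
      have h2 := Set.indicator_of_notMem this (1 : (Fin r → ℝ) → ENNReal)
      change _ = h (fun j => (z j).re) * Box.indicator 1 (fun j => (z j).im)
      rw [h2]; simp
  rw [h1, Measure.volume_eq_prod, lintegral_prod_mul hh.aemeasurable
    (measurable_one.indicator hBm).aemeasurable, lintegral_indicator_one hBm, hvol, mul_comm]

lemma continuous_kacRice :
    Continuous fun p : (∀ i, K i → ℂ) × (Fin r → ℂ) => kacRice e p.1 p.2 := by
  have h1 := fun i k => continuous_expMon e i k
  have h2 : Continuous fun p : (∀ i, K i → ℂ) × (Fin r → ℂ) => (expJac e p.1 p.2).det := by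
    refine Continuous.matrix_det (continuous_matrix fun i j => ?_)
    simp only [expJac, Matrix.of_apply]
    fun_prop
  have h3 : ∀ i, Continuous fun p : (∀ i, K i → ℂ) × (Fin r → ℂ) => expSys e p.1 p.2 i := by
    intro i
    simp only [expSys]
    fun_prop
  unfold kacRice
  fun_prop

lemma continuous_mixedDisc_covMat :
    Continuous fun x : Fin r → ℝ => mixedDisc fun i => covMat e i x := by
  have h0 : ∀ i (x : Fin r → ℝ), 1 + ∑ k, Real.exp (2 * ∑ m, e i k m * x m) ≠ 0 :=
    fun i x => by positivity
  have h : ∀ i j l, Continuous fun x : Fin r → ℝ => covMat e i x j l := by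
    intro i j l
    simp only [covMat, Matrix.of_apply]
    refine Continuous.sub (Continuous.div (by fun_prop) (by fun_prop) fun x => h0 i x)
      (Continuous.div (by fun_prop) (by fun_prop) fun x => pow_ne_zero 2 (h0 i x))
  unfold mixedDisc
  fun_prop

lemma lintegral_kacRice (z : Fin r → ℂ) :
    ∫⁻ c, ENNReal.ofReal (kacRice e c z) =
      ENNReal.ofReal (Real.pi ^ (∑ i, Fintype.card (K i))) *
        ENNReal.ofReal (mixedDisc fun i => covMat e i fun j => (z j).re) := by
  rw [← ofReal_integral_eq_lintegral_ofReal (integrable_kacRice e z)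
    (Filter.Eventually.of_forall fun c => by unfold kacRice; positivity), integral_kacRice,
    ENNReal.ofReal_mul (by positivity)]

lemma integrable_prod_exp_neg_norm_sq (ι : Type*) [Fintype ι] :
    Integrable fun c : ι → ℂ => ∏ i, Real.exp (-‖c i‖ ^ 2) :=
  Integrable.fintype_prod (f := fun _ (z : ℂ) => Real.exp (-‖z‖ ^ 2))
    fun _ => integrable_exp_neg_norm_sq

lemma integral_prod_exp_neg_norm_sq (ι : Type*) [Fintype ι] :
    ∫ c : ι → ℂ, ∏ i, Real.exp (-‖c i‖ ^ 2) = Real.pi ^ Fintype.card ι := by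
  rw [integral_fintype_prod_volume_eq_prod fun _ (z : ℂ) => Real.exp (-‖z‖ ^ 2)]
  have h := Complex.integral_exp_neg_rpow (p := 2) (by norm_num)
  simp only [Real.rpow_two] at h
  rw [div_self two_ne_zero, one_add_one_eq_two, Real.Gamma_two, mul_one] at h
  simp [h]

lemma lintegral_prod_exp_neg_norm_sq (ι : Type*) [Fintype ι] :
    ∫⁻ c : ι → ℂ, ENNReal.ofReal (∏ i, Real.exp (-‖c i‖ ^ 2)) =
      ENNReal.ofReal (Real.pi ^ Fintype.card ι) := by
  rw [← integral_prod_exp_neg_norm_sq, ofReal_integral_eq_lintegral_ofReal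
    (integrable_prod_exp_neg_norm_sq ι) (Filter.Eventually.of_forall fun c => by positivity)]

lemma lintegral_prod_prod_exp_neg_norm_sq :
    ∫⁻ c : ∀ i, K i → ℂ, ENNReal.ofReal (∏ i, ∏ k, Real.exp (-‖c i k‖ ^ 2)) =
      ENNReal.ofReal (Real.pi ^ (∑ i, Fintype.card (K i))) := by
  have hintegrable : Integrable fun c : ∀ i, K i → ℂ => ∏ i, ∏ k, Real.exp (-‖c i k‖ ^ 2) :=
    Integrable.fintype_prod_dep (f := fun i (d : K i → ℂ) => ∏ k, Real.exp (-‖d k‖ ^ 2))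
      fun i => integrable_prod_exp_neg_norm_sq (K i)
  rw [← ofReal_integral_eq_lintegral_ofReal hintegrable
      (Filter.Eventually.of_forall fun c => by positivity),
    integral_fintype_prod_volume_eq_prod fun i (d : K i → ℂ) => ∏ k, Real.exp (-‖d k‖ ^ 2)]
  simp only [integral_prod_exp_neg_norm_sq, Finset.prod_pow_eq_pow_sum]

/-- If for almost all coefficients the exponential system has `N` solutions in the fundamental
strip, then `N` is given by the integral of the mixed discriminant of covariance matrices. -/
lemma count_eq_lintegral_mixedDisc (N : ENNReal)
    (hN : ∀ᵐ c : ∀ i, K i → ℂ, ∀ᵐ b : Fin r → ℂ,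
      Measure.count {z ∈ expStrip r | expSys e c z = b} = N) :
    N = ENNReal.ofReal (2 ^ r) *
      ∫⁻ x, ENNReal.ofReal (mixedDisc fun i => covMat e i x) := by
  set G : (Fin r → ℂ) → ENNReal := fun b => ENNReal.ofReal (∏ i, Real.exp (-‖b i‖ ^ 2)) with hG
  set H : (∀ i, K i → ℂ) → ENNReal :=
    fun c => ENNReal.ofReal (∏ i, ∏ k, Real.exp (-‖c i k‖ ^ 2)) with hH
  set m := ∑ i, Fintype.card (K i) with hm
  have hGm : Measurable G := by rw [hG]; fun_prop
  have hHm : Measurable H := by rw [hH]; fun_prop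
  have hpi : (0 : ℝ) < Real.pi := Real.pi_pos
  have h1 : ∫⁻ c, (∫⁻ b, Measure.count {z ∈ expStrip r | expSys e c z = b} * G b) * H c =
      N * ENNReal.ofReal (Real.pi ^ r) * ENNReal.ofReal (Real.pi ^ m) := by
    have : ∀ᵐ c, (∫⁻ b, Measure.count {z ∈ expStrip r | expSys e c z = b} * G b) * H c =
        (N * ENNReal.ofReal (Real.pi ^ r)) * H c := by
      filter_upwards [hN] with c hc
      congr 1
      have h2 : ∀ᵐ b, Measure.count {z ∈ expStrip r | expSys e c z = b} * G b = N * G b := by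
        filter_upwards [hc] with b hb
        rw [hb]
      rw [lintegral_congr_ae h2, lintegral_const_mul _ hGm, hG, lintegral_prod_exp_neg_norm_sq,
        Fintype.card_fin]
    rw [lintegral_congr_ae this, lintegral_const_mul _ hHm, hH,
      lintegral_prod_prod_exp_neg_norm_sq]
  have h2 : ∫⁻ c, (∫⁻ b, Measure.count {z ∈ expStrip r | expSys e c z = b} * G b) * H c =
      ∫⁻ c, ∫⁻ z in expStrip r, ENNReal.ofReal (kacRice e c z) := by
    refine lintegral_congr fun c => ?_
    rw [lintegral_count_expSys e c (measurableSet_expStrip r) G hGm,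
      ← lintegral_mul_const' _ _ (by simp [hH])]
    refine lintegral_congr fun z => ?_
    rw [kacRice, ENNReal.ofReal_mul (by positivity), ENNReal.ofReal_mul (by positivity)]
  have h3 : ∫⁻ c, ∫⁻ z in expStrip r, ENNReal.ofReal (kacRice e c z) =
      ∫⁻ z in expStrip r, ENNReal.ofReal (Real.pi ^ m) *
        ENNReal.ofReal (mixedDisc fun i => covMat e i fun j => (z j).re) := by
    rw [lintegral_lintegral_swap
      ((continuous_kacRice e).measurable.ennreal_ofReal.aemeasurable)]
    exact lintegral_congr fun z => lintegral_kacRice e z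
  have hM : Measurable fun x : Fin r → ℝ =>
      ENNReal.ofReal (mixedDisc fun i => covMat e i x) :=
    (continuous_mixedDisc_covMat e).measurable.ennreal_ofReal
  rw [h2, h3, lintegral_expStrip r (fun x => ENNReal.ofReal (Real.pi ^ m) *
    ENNReal.ofReal (mixedDisc fun i => covMat e i x)) (hM.const_mul _),
    lintegral_const_mul _ hM, mul_pow, ENNReal.ofReal_mul (by positivity)] at h1
  have hπm0 : ENNReal.ofReal (Real.pi ^ m) ≠ 0 := by simp; positivity
  have hπr0 : ENNReal.ofReal (Real.pi ^ r) ≠ 0 := by simp; positivity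
  refine (ENNReal.mul_left_inj (c := ENNReal.ofReal (Real.pi ^ r) * ENNReal.ofReal (Real.pi ^ m))
    (mul_ne_zero hπr0 hπm0) (by finiteness)).1 ?_
  rw [← mul_assoc, ← h1]
  ring

end ExpSystem

section MomentMap

variable {r : ℕ} {K : Fin r → Type} (e : ∀ i, K i → Fin r → ℝ)

/-- The unnormalized Gibbs weight of `e i k`. -/
def gibbsWeight (i : Fin r) (k : K i) (x : Fin r → ℝ) : ℝ :=
  Real.exp (2 * ∑ m, e i k m * x m)

lemma gibbsWeight_pos (i : Fin r) (k : K i) (x : Fin r → ℝ) : 0 < gibbsWeight e i k x :=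
  Real.exp_pos _

lemma hasFDerivAt_gibbsWeight (i : Fin r) (k : K i) (x : Fin r → ℝ) :
    HasFDerivAt (gibbsWeight e i k) (gibbsWeight e i k x • ((2 : ℝ) • ∑ m, e i k m •
      ContinuousLinearMap.proj (R := ℝ) (φ := fun _ : Fin r => ℝ) m)) x := by
  have h1 : HasFDerivAt (fun x : Fin r → ℝ => ∑ m, e i k m * x m)
      (∑ m, e i k m • ContinuousLinearMap.proj (R := ℝ) (φ := fun _ : Fin r => ℝ) m) x :=
    HasFDerivAt.fun_sum fun j _ =>
      ((ContinuousLinearMap.proj (R := ℝ) (φ := fun _ : Fin r => ℝ) j).hasFDerivAt).const_mul _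
  exact (h1.const_mul 2).exp

/-- The convex hull of `{0} ∪ {e i k}`. -/
def suppHull (i : Fin r) : Set (Fin r → ℝ) := convexHull ℝ (insert 0 (Set.range (e i)))

lemma suppHull_subset_of_forall_eq_zero (i : Fin r) (v : Fin r → ℝ)
    (hv : ∀ k, ∑ j, e i k j * v j = 0) {q : Fin r → ℝ} (hq : q ∈ suppHull e i) :
    ∑ j, q j * v j = 0 := by
  have h : convexHull ℝ (insert 0 (Set.range (e i))) ⊆
      (LinearMap.ker (∑ j, v j • LinearMap.proj (R := ℝ) (φ := fun _ : Fin r => ℝ) j) :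
        Submodule ℝ (Fin r → ℝ)) := by
    refine convexHull_min ?_ (Submodule.convex _)
    rintro _ (rfl | ⟨k, rfl⟩)
    · simp
    · simpa [mul_comm] using hv k
  simpa [mul_comm] using h hq

variable [∀ i, Fintype (K i)]

/-- The partition function of the Gibbs measure on `{0} ∪ {e i k}`. -/
def partFun (i : Fin r) (x : Fin r → ℝ) : ℝ := 1 + ∑ k, gibbsWeight e i k x

/-- The mean of the Gibbs measure on `{0} ∪ {e i k}`. -/
def gibbsMean (i : Fin r) (x : Fin r → ℝ) : Fin r → ℝ :=
  fun j => (∑ k, e i k j * gibbsWeight e i k x) / partFun e i x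

lemma one_le_partFun (i : Fin r) (x : Fin r → ℝ) : 1 ≤ partFun e i x :=
  le_add_of_nonneg_right (Finset.sum_nonneg fun k _ => (gibbsWeight_pos e i k x).le)

lemma partFun_pos (i : Fin r) (x : Fin r → ℝ) : 0 < partFun e i x :=
  one_pos.trans_le (one_le_partFun e i x)

lemma covMat_apply (i : Fin r) (x : Fin r → ℝ) (j l : Fin r) :
    covMat e i x j l = (∑ k, e i k j * e i k l * gibbsWeight e i k x) / partFun e i x -
      (∑ k, e i k j * gibbsWeight e i k x) * (∑ k, e i k l * gibbsWeight e i k x) /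
        partFun e i x ^ 2 := rfl

lemma hasFDerivAt_partFun (i : Fin r) (x : Fin r → ℝ) :
    HasFDerivAt (partFun e i) (∑ k, gibbsWeight e i k x • ((2 : ℝ) • ∑ m, e i k m •
      ContinuousLinearMap.proj (R := ℝ) (φ := fun _ : Fin r => ℝ) m)) x :=
  (HasFDerivAt.fun_sum fun k _ => hasFDerivAt_gibbsWeight e i k x).const_add 1

lemma hasFDerivAt_gibbsMean (i : Fin r) (x : Fin r → ℝ) :
    HasFDerivAt (gibbsMean e i)
      (Matrix.toLin' ((2 : ℝ) • covMat e i x)).toContinuousLinearMap x := by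
  rw [hasFDerivAt_pi']
  intro j
  have h1 := (HasFDerivAt.fun_sum (u := Finset.univ) fun k _ =>
    (hasFDerivAt_gibbsWeight e i k x).const_mul (e i k j)).mul
      ((hasDerivAt_inv (partFun_pos e i x).ne').comp_hasFDerivAt x (hasFDerivAt_partFun e i x))
  refine h1.congr_fderiv ?_
  have hZ := (partFun_pos e i x).ne'
  ext y
  simp only [add_apply, sum_apply, smul_apply, ContinuousLinearMap.proj_apply, smul_eq_mul,
    ContinuousLinearMap.comp_apply, LinearMap.coe_toContinuousLinearMap', Matrix.toLin'_apply,
    Matrix.mulVec, dotProduct, Matrix.smul_apply, covMat_apply, Function.comp_apply]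
  have h2 : ∀ l, 2 * ((∑ k, e i k j * e i k l * gibbsWeight e i k x) / partFun e i x -
      (∑ k, e i k j * gibbsWeight e i k x) * (∑ k, e i k l * gibbsWeight e i k x) /
        partFun e i x ^ 2) * y l = (∑ k, 2 * (e i k j * e i k l * gibbsWeight e i k x) * y l) /
        partFun e i x - (∑ k, e i k j * gibbsWeight e i k x) *
        (∑ k, 2 * (e i k l * gibbsWeight e i k x) * y l) / partFun e i x ^ 2 := by
    intro l
    rw [← Finset.sum_mul, ← Finset.mul_sum, ← Finset.sum_mul, ← Finset.mul_sum]
    ring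
  rw [Finset.sum_congr rfl fun l _ => h2 l, Finset.sum_sub_distrib, ← Finset.sum_div,
    ← Finset.sum_div, ← Finset.mul_sum, Finset.sum_comm,
    Finset.sum_comm (f := fun l k => 2 * (e i k l * gibbsWeight e i k x) * y l)]
  have h3 : ∀ k, e i k j * (gibbsWeight e i k x * (2 * ∑ m, e i k m * y m)) =
      ∑ l, 2 * (e i k j * e i k l * gibbsWeight e i k x) * y l := by
    intro k
    rw [Finset.mul_sum, Finset.mul_sum, Finset.mul_sum]
    exact Finset.sum_congr rfl fun l _ => by ring
  have h4 : ∀ k, gibbsWeight e i k x * (2 * ∑ m, e i k m * y m) =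
      ∑ l, 2 * (e i k l * gibbsWeight e i k x) * y l := by
    intro k
    rw [Finset.mul_sum, Finset.mul_sum]
    exact Finset.sum_congr rfl fun l _ => by ring
  rw [Finset.sum_congr rfl fun k _ => h3 k, Finset.sum_congr rfl fun k _ => h4 k]
  field_simp
  ring

lemma sum_sum_covMat (i : Fin r) (x v : Fin r → ℝ) :
    ∑ j, ∑ l, v j * covMat e i x j l * v l =
      (partFun e i x * (∑ k, (∑ j, e i k j * v j) ^ 2 * gibbsWeight e i k x) -
        (∑ k, (∑ j, e i k j * v j) * gibbsWeight e i k x) ^ 2) / partFun e i x ^ 2 := by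
  have hZ := (partFun_pos e i x).ne'
  have h1 : ∑ k, (∑ j, e i k j * v j) ^ 2 * gibbsWeight e i k x =
      ∑ j, ∑ l, v j * (∑ k, e i k j * e i k l * gibbsWeight e i k x) * v l := by
    simp_rw [sq, Finset.sum_mul_sum, Finset.mul_sum, Finset.sum_mul]
    rw [Finset.sum_comm]
    refine Finset.sum_congr rfl fun j _ => ?_
    rw [Finset.sum_comm]
    exact Finset.sum_congr rfl fun l _ => Finset.sum_congr rfl fun k _ => by ring
  have h2 : ∑ k, (∑ j, e i k j * v j) * gibbsWeight e i k x =
      ∑ j, v j * ∑ k, e i k j * gibbsWeight e i k x := by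
    simp_rw [Finset.mul_sum, Finset.sum_mul]
    rw [Finset.sum_comm]
    exact Finset.sum_congr rfl fun l _ => Finset.sum_congr rfl fun k _ => by ring
  rw [h1, h2, sq (∑ j, v j * _), Finset.sum_mul_sum, Finset.mul_sum, ← Finset.sum_sub_distrib,
    Finset.sum_div]
  refine Finset.sum_congr rfl fun j _ => ?_
  rw [Finset.mul_sum, ← Finset.sum_sub_distrib, Finset.sum_div]
  refine Finset.sum_congr rfl fun l _ => ?_
  rw [covMat_apply]
  field_simp

lemma div_le_sum_sum_covMat (i : Fin r) (x v : Fin r → ℝ) :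
    (∑ k, (∑ j, e i k j * v j) ^ 2 * gibbsWeight e i k x) / partFun e i x ^ 2 ≤
      ∑ j, ∑ l, v j * covMat e i x j l * v l := by
  rw [sum_sum_covMat]
  gcongr
  have h := Finset.sum_sq_le_sum_mul_sum_of_sq_le_mul (Finset.univ : Finset (K i))
    (r := fun k => (∑ j, e i k j * v j) * gibbsWeight e i k x)
    (f := fun k => (∑ j, e i k j * v j) ^ 2 * gibbsWeight e i k x)
    (g := fun k => gibbsWeight e i k x)
    (fun k _ => mul_nonneg (sq_nonneg _) (gibbsWeight_pos e i k x).le)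
    (fun k _ => (gibbsWeight_pos e i k x).le) (fun k _ => le_of_eq (by ring))
  rw [partFun]
  linarith

lemma sum_sum_covMat_nonneg (i : Fin r) (x v : Fin r → ℝ) :
    0 ≤ ∑ j, ∑ l, v j * covMat e i x j l * v l :=
  (div_nonneg (Finset.sum_nonneg fun k _ => mul_nonneg (sq_nonneg _) (gibbsWeight_pos e i k x).le)
    (sq_nonneg _)).trans (div_le_sum_sum_covMat e i x v)

lemma sum_sum_covMat_pos (i : Fin r) (x v : Fin r → ℝ) (k : K i) (hk : ∑ j, e i k j * v j ≠ 0) :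
    0 < ∑ j, ∑ l, v j * covMat e i x j l * v l := by
  refine lt_of_lt_of_le (div_pos ?_ (pow_pos (partFun_pos e i x) 2)) (div_le_sum_sum_covMat e i x v)
  exact Finset.sum_pos' (fun k _ => mul_nonneg (sq_nonneg _) (gibbsWeight_pos e i k x).le)
    ⟨k, Finset.mem_univ k, mul_pos (by positivity) (gibbsWeight_pos e i k x)⟩

lemma gibbsMean_mem (i : Fin r) (x : Fin r → ℝ) : gibbsMean e i x ∈ suppHull e i := by
  have h := (convex_convexHull ℝ (insert 0 (Set.range (e i)))).sum_mem
    (t := (Finset.univ : Finset (Option (K i))))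
    (w := fun o => o.elim 1 (fun k => gibbsWeight e i k x) / partFun e i x)
    (z := fun o => o.elim 0 (e i)) ?_ ?_ ?_
  · rw [suppHull]
    convert h using 1
    rw [Fintype.sum_option]
    ext j
    simp only [gibbsMean, Finset.sum_div, Option.elim_none, Option.elim_some, smul_zero, zero_add,
      Finset.sum_apply, Pi.smul_apply, smul_eq_mul]
    exact Finset.sum_congr rfl fun k _ => by ring
  · rintro (_ | k) -
    · exact div_nonneg zero_le_one (partFun_pos e i x).le
    · exact div_nonneg (gibbsWeight_pos e i k x).le (partFun_pos e i x).le
  · rw [← Finset.sum_div, Fintype.sum_option]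
    exact div_self (partFun_pos e i x).ne'
  · rintro (_ | k) -
    · exact subset_convexHull ℝ _ (Set.mem_insert _ _)
    · exact subset_convexHull ℝ _ (Set.mem_insert_of_mem _ ⟨k, rfl⟩)

/-- The support function of `suppHull` is bounded by half the logarithm of the partition
function. -/
lemma sum_mul_le_log_partFun (i : Fin r) (x : Fin r → ℝ) {q : Fin r → ℝ}
    (hq : q ∈ suppHull e i) : ∑ j, q j * x j ≤ Real.log (partFun e i x) / 2 := by
  have hlin : IsLinearMap ℝ fun q : Fin r → ℝ => ∑ j, q j * x j :=
    ⟨fun a b => by simp [add_mul, Finset.sum_add_distrib], fun c a => by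
      simp [Finset.mul_sum, mul_assoc]⟩
  have h : convexHull ℝ (insert 0 (Set.range (e i))) ⊆
      {q | ∑ j, q j * x j ≤ Real.log (partFun e i x) / 2} := by
    refine convexHull_min ?_ (convex_halfSpace_le hlin _)
    rintro _ (rfl | ⟨k, rfl⟩)
    · simpa using div_nonneg (Real.log_nonneg (one_le_partFun e i x)) zero_le_two
    · have h1 : gibbsWeight e i k x ≤ partFun e i x :=
        (Finset.single_le_sum (fun k _ => (gibbsWeight_pos e i k x).le)
          (Finset.mem_univ k)).trans (le_add_of_nonneg_left zero_le_one)
      have h2 := Real.log_le_log (gibbsWeight_pos e i k x) h1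
      rw [gibbsWeight, Real.log_exp] at h2
      rw [Set.mem_ofPred_eq]
      linarith
  exact h hq

lemma isCompact_suppHull (i : Fin r) : IsCompact (suppHull e i) :=
  ((Set.finite_range (e i)).insert 0).isCompact_convexHull ℝ

end MomentMap

section MomentMap

variable {r : ℕ} {K : Fin r → Type} (e : ∀ i, K i → Fin r → ℝ)

lemma convex_sum_suppHull (s : Finset (Fin r)) : Convex ℝ (∑ i ∈ s, suppHull e i) :=
  convex_sum _ fun _ _ => convex_convexHull ℝ _

variable [∀ i, Fintype (K i)]

/-- The moment map of a subfamily. -/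
def momentMap (s : Finset (Fin r)) (x : Fin r → ℝ) : Fin r → ℝ := ∑ i ∈ s, gibbsMean e i x

/-- The Jacobian matrix of `momentMap`. -/
def momentJac (s : Finset (Fin r)) (x : Fin r → ℝ) : Matrix (Fin r) (Fin r) ℝ :=
  ∑ i ∈ s, (2 : ℝ) • covMat e i x

lemma hasFDerivAt_momentMap (s : Finset (Fin r)) (x : Fin r → ℝ) :
    HasFDerivAt (momentMap e s) (Matrix.toLin' (momentJac e s x)).toContinuousLinearMap x := by
  have h : HasFDerivAt (momentMap e s)
      (∑ i ∈ s, (Matrix.toLin' ((2 : ℝ) • covMat e i x)).toContinuousLinearMap) x := by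
    have h := HasFDerivAt.sum (u := s) fun i _ => hasFDerivAt_gibbsMean e i x
    have h2 : momentMap e s = ∑ i ∈ s, gibbsMean e i := by
      ext y j
      simp [momentMap]
    rw [h2]
    exact h
  rwa [momentJac, map_sum, map_sum]

lemma momentMap_mem (s : Finset (Fin r)) (x : Fin r → ℝ) :
    momentMap e s x ∈ ∑ i ∈ s, suppHull e i :=
  Set.finsetSum_mem_finsetSum _ _ _ fun i _ => gibbsMean_mem e i x

lemma dotProduct_momentJac_mulVec (s : Finset (Fin r)) (x v : Fin r → ℝ) :
    v ⬝ᵥ (momentJac e s x).mulVec v =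
      ∑ i ∈ s, 2 * ∑ j, ∑ l, v j * covMat e i x j l * v l := by
  simp only [dotProduct, Matrix.mulVec, momentJac, Matrix.sum_apply, Matrix.smul_apply,
    smul_eq_mul, Finset.sum_mul, Finset.mul_sum]
  rw [Finset.sum_congr rfl fun j _ => Finset.sum_comm, Finset.sum_comm]
  exact Finset.sum_congr rfl fun i _ => Finset.sum_congr rfl fun j _ =>
    Finset.sum_congr rfl fun l _ => by ring

lemma dotProduct_momentJac_mulVec_pos {s : Finset (Fin r)} (x v : Fin r → ℝ) {i : Fin r}
    (hi : i ∈ s) (k : K i) (hk : ∑ j, e i k j * v j ≠ 0) :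
    0 < v ⬝ᵥ (momentJac e s x).mulVec v := by
  rw [dotProduct_momentJac_mulVec]
  exact Finset.sum_pos' (fun i _ => mul_nonneg zero_le_two (sum_sum_covMat_nonneg e i x v))
    ⟨i, hi, mul_pos two_pos (sum_sum_covMat_pos e i x v k hk)⟩

lemma posSemidef_momentJac (s : Finset (Fin r)) (x : Fin r → ℝ) :
    (momentJac e s x).PosSemidef := by
  refine Matrix.PosSemidef.of_dotProduct_mulVec_nonneg ?_ fun v => ?_
  · ext j l
    simp only [momentJac, Matrix.conjTranspose_apply, Matrix.sum_apply, Matrix.smul_apply,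
      covMat_apply, star_trivial]
    refine Finset.sum_congr rfl fun i _ => ?_
    congr 2
    · congr 1
      exact Finset.sum_congr rfl fun k _ => by ring
    · rw [mul_comm]
  · rw [star_trivial, dotProduct_momentJac_mulVec]
    exact Finset.sum_nonneg fun i _ => mul_nonneg zero_le_two (sum_sum_covMat_nonneg e i x v)

lemma injective_momentMap {s : Finset (Fin r)}
    (hs : ∀ v : Fin r → ℝ, v ≠ 0 → ∃ i ∈ s, ∃ k, ∑ j, e i k j * v j ≠ 0) :
    Function.Injective (momentMap e s) := by
  intro x y hxy
  by_contra hne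
  obtain ⟨i, hi, k, hk⟩ := hs (y - x) (sub_ne_zero.2 (Ne.symm hne))
  have hd : ∀ t : ℝ, HasDerivAt (fun t : ℝ => (y - x) ⬝ᵥ momentMap e s (x + t • (y - x)))
      ((y - x) ⬝ᵥ (momentJac e s (x + t • (y - x))).mulVec (y - x)) t := by
    intro t
    have h1 : HasDerivAt (fun t : ℝ => x + t • (y - x)) (y - x) t := by
      simpa using ((hasDerivAt_id t).smul_const (y - x)).const_add x
    have h2 := (hasFDerivAt_momentMap e s (x + t • (y - x))).comp_hasDerivAt t h1
    rw [hasDerivAt_pi] at h2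
    exact HasDerivAt.fun_sum fun j _ => (h2 j).const_mul ((y - x) j)
  have hmono := strictMono_of_hasDerivAt_pos hd fun t =>
    dotProduct_momentJac_mulVec_pos e _ _ hi k hk
  have := hmono zero_lt_one
  simp [hxy] at this

/-- The convex potential whose gradient is the moment map. -/
def momentPot (s : Finset (Fin r)) (x : Fin r → ℝ) : ℝ := ∑ i ∈ s, Real.log (partFun e i x) / 2

lemma hasFDerivAt_momentPot (s : Finset (Fin r)) (x : Fin r → ℝ) :
    HasFDerivAt (momentPot e s) (∑ j, momentMap e s x j •
      ContinuousLinearMap.proj (R := ℝ) (φ := fun _ : Fin r => ℝ) j) x := by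
  have h1 := HasFDerivAt.fun_sum (u := s) fun i _ =>
    ((hasFDerivAt_partFun e i x).log (partFun_pos e i x).ne').mul_const (1 / 2 : ℝ)
  have h2 : momentPot e s = fun x => ∑ i ∈ s, Real.log (partFun e i x) * (1 / 2) := by
    ext x
    simp [momentPot, div_eq_mul_inv]
  rw [h2]
  refine h1.congr_fderiv ?_
  ext y
  simp only [sum_apply, smul_apply, ContinuousLinearMap.proj_apply, smul_eq_mul, momentMap,
    Finset.sum_apply, gibbsMean, Finset.sum_mul, Finset.mul_sum, Finset.sum_div]
  rw [Finset.sum_comm]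
  refine Finset.sum_congr rfl fun i _ => ?_
  rw [Finset.sum_comm]
  refine Finset.sum_congr rfl fun j _ => Finset.sum_congr rfl fun k _ => ?_
  ring

lemma sum_mul_le_momentPot (s : Finset (Fin r)) (x : Fin r → ℝ) {q : Fin r → ℝ}
    (hq : q ∈ ∑ i ∈ s, suppHull e i) : ∑ j, q j * x j ≤ momentPot e s x := by
  obtain ⟨g, hg, rfl⟩ := (Set.mem_finsetSum _ _ _).1 hq
  simp only [Finset.sum_apply, Finset.sum_mul]
  rw [Finset.sum_comm]
  exact Finset.sum_le_sum fun i hi => sum_mul_le_log_partFun e i x (hg hi)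

lemma interior_subset_range_momentMap (s : Finset (Fin r)) :
    interior (∑ i ∈ s, suppHull e i) ⊆ Set.range (momentMap e s) := by
  intro p hp
  obtain ⟨ε, hε, hball⟩ := Metric.isOpen_iff.1 isOpen_interior p hp
  set F : (Fin r → ℝ) → ℝ := fun x => momentPot e s x - ∑ j, p j * x j with hF
  have hFd : ∀ x, HasFDerivAt F ((∑ j, momentMap e s x j •
      ContinuousLinearMap.proj (R := ℝ) (φ := fun _ : Fin r => ℝ) j) -
      ∑ j, p j • ContinuousLinearMap.proj (R := ℝ) (φ := fun _ : Fin r => ℝ) j) x := by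
    intro x
    refine (hasFDerivAt_momentPot e s x).sub ?_
    exact HasFDerivAt.fun_sum fun j _ =>
      ((ContinuousLinearMap.proj (R := ℝ) (φ := fun _ : Fin r => ℝ) j).hasFDerivAt).const_mul _
  have hFc : Continuous F := continuous_iff_continuousAt.2 fun x => (hFd x).continuousAt
  have hbound : ∀ x, ε / 2 * ‖x‖ ≤ F x := by
    intro x
    rcases eq_or_ne x 0 with rfl | hx
    · have := sum_mul_le_momentPot e s 0 (interior_subset hp)
      simpa [hF] using this
    have hx' : 0 < ‖x‖ := norm_pos_iff.2 hx
    have hq : p + (ε / (2 * ‖x‖)) • x ∈ ∑ i ∈ s, suppHull e i := by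
      refine interior_subset (hball ?_)
      rw [Metric.mem_ball, dist_eq_norm, add_sub_cancel_left, norm_smul, Real.norm_eq_abs,
        abs_of_pos (by positivity)]
      field_simp
      linarith
    have h1 := sum_mul_le_momentPot e s x hq
    simp only [Pi.add_apply, Pi.smul_apply, smul_eq_mul, add_mul, Finset.sum_add_distrib,
      mul_assoc, ← Finset.mul_sum] at h1
    have h2 : ‖x‖ ^ 2 ≤ ∑ j, x j * x j := by
      have : Nonempty (Fin r) := by
        by_contra h
        rw [not_nonempty_iff] at h
        exact hx (Subsingleton.elim _ _)
      obtain ⟨j, hj⟩ := Finite.exists_max fun j => ‖x j‖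
      have h3 : ‖x‖ ≤ ‖x j‖ := (pi_norm_le_iff_of_nonneg (norm_nonneg _)).2 hj
      calc ‖x‖ ^ 2 ≤ ‖x j‖ ^ 2 := by gcongr
        _ = x j * x j := by rw [Real.norm_eq_abs, sq_abs, sq]
        _ ≤ _ := Finset.single_le_sum (f := fun j => x j * x j)
          (fun j _ => mul_self_nonneg _) (Finset.mem_univ j)
    have h3 : ε / (2 * ‖x‖) * ‖x‖ ^ 2 ≤ ε / (2 * ‖x‖) * ∑ j, x j * x j := by gcongr
    have h4 : ε / (2 * ‖x‖) * ‖x‖ ^ 2 = ε / 2 * ‖x‖ := by field_simp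
    rw [hF]
    linarith
  have hlim : Filter.Tendsto F (Filter.cocompact _) Filter.atTop :=
    Filter.tendsto_atTop_mono hbound
      ((tendsto_norm_cocompact_atTop).const_mul_atTop (by positivity))
  obtain ⟨x, hx⟩ := hFc.exists_forall_le hlim
  refine ⟨x, ?_⟩
  have h0 := IsLocalMin.hasFDerivAt_eq_zero (Filter.Eventually.of_forall hx) (hFd x)
  ext j
  have := DFunLike.congr_fun h0 (Pi.single j 1)
  simpa [Pi.single_apply, sub_eq_zero] using this

lemma isCompact_sum_suppHull (s : Finset (Fin r)) : IsCompact (∑ i ∈ s, suppHull e i) := by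
  classical
  induction s using Finset.induction_on with
  | empty => simp
  | insert i s hi ih => rw [Finset.sum_insert hi]; exact (isCompact_suppHull e i).add ih

lemma lintegral_det_momentJac (s : Finset (Fin r)) :
    ∫⁻ x, ENNReal.ofReal (momentJac e s x).det = volume (∑ i ∈ s, suppHull e i) := by
  by_cases hs : ∀ v : Fin r → ℝ, v ≠ 0 → ∃ i ∈ s, ∃ k, ∑ j, e i k j * v j ≠ 0
  · have h1 := lintegral_abs_det_fderiv_eq_addHaar_image volume MeasurableSet.univ
      (fun x _ => (hasFDerivAt_momentMap e s x).hasFDerivWithinAt)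
      (injective_momentMap e hs).injOn
    have h2 : volume (momentMap e s '' Set.univ) = volume (∑ i ∈ s, suppHull e i) := by
      refine le_antisymm (measure_mono ?_) ?_
      · rintro _ ⟨x, -, rfl⟩
        exact momentMap_mem e s x
      · have h3 : ∑ i ∈ s, suppHull e i ⊆ momentMap e s '' Set.univ ∪
            frontier (∑ i ∈ s, suppHull e i) := by
          intro q hq
          by_cases hq' : q ∈ interior (∑ i ∈ s, suppHull e i)
          · left
            rw [Set.image_univ]
            exact interior_subset_range_momentMap e s hq'
          · exact Or.inr ⟨subset_closure hq, hq'⟩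
        refine (measure_mono h3).trans ((measure_union_le _ _).trans ?_)
        rw [(convex_sum_suppHull e s).addHaar_frontier volume, add_zero]
    rw [← h2, ← h1, Measure.restrict_univ]
    refine lintegral_congr fun x => ?_
    rw [LinearMap.det_toContinuousLinearMap, LinearMap.det_toLin',
      abs_of_nonneg (posSemidef_momentJac e s x).det_nonneg]
  · push Not at hs
    obtain ⟨v, hv, hv0⟩ := hs
    have h1 : ∀ x, (momentJac e s x).det = 0 := by
      intro x
      refine Matrix.exists_mulVec_eq_zero_iff.1 ⟨v, hv, ?_⟩
      rw [momentJac, Matrix.sum_mulVec]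
      refine Finset.sum_eq_zero fun i hi => ?_
      ext j
      simp only [Matrix.mulVec, dotProduct, Matrix.smul_apply, covMat_apply, smul_eq_mul,
        Pi.zero_apply]
      have h2 : ∑ l, (∑ k, e i k j * e i k l * gibbsWeight e i k x) * v l = 0 := by
        simp_rw [Finset.sum_mul]
        rw [Finset.sum_comm]
        refine Finset.sum_eq_zero fun k _ => ?_
        have := hv0 i hi k
        rw [← mul_zero (e i k j * gibbsWeight e i k x), ← this, Finset.mul_sum]
        exact Finset.sum_congr rfl fun l _ => by ring
      have h3 : ∑ l, (∑ k, e i k l * gibbsWeight e i k x) * v l = 0 := by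
        simp_rw [Finset.sum_mul]
        rw [Finset.sum_comm]
        refine Finset.sum_eq_zero fun k _ => ?_
        have := hv0 i hi k
        rw [← mul_zero (gibbsWeight e i k x), ← this, Finset.mul_sum]
        exact Finset.sum_congr rfl fun l _ => by ring
      calc _ = 2 / partFun e i x *
            (∑ l, (∑ k, e i k j * e i k l * gibbsWeight e i k x) * v l) -
            2 * (∑ k, e i k j * gibbsWeight e i k x) / partFun e i x ^ 2 *
              ∑ l, (∑ k, e i k l * gibbsWeight e i k x) * v l := by
            rw [Finset.mul_sum, Finset.mul_sum, ← Finset.sum_sub_distrib]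
            exact Finset.sum_congr rfl fun l _ => by ring
        _ = 0 := by rw [h2, h3]; ring
    simp only [h1, ENNReal.ofReal_zero, lintegral_zero]
    set W : Submodule ℝ (Fin r → ℝ) :=
      LinearMap.ker (∑ j, v j • LinearMap.proj (R := ℝ) (φ := fun _ : Fin r => ℝ) j) with hW
    have hWm : ∀ q, q ∈ W ↔ ∑ j, q j * v j = 0 := by
      intro q
      simp [hW, mul_comm]
    have hWt : W ≠ ⊤ := by
      intro h
      have h2 : v ∈ W := h ▸ Submodule.mem_top
      rw [hWm, Finset.sum_mul_self_eq_zero_iff] at h2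
      exact hv (funext fun j => by simpa using h2 j)
    refine (measure_mono_null ?_ (Measure.addHaar_submodule volume W hWt)).symm
    intro q hq
    obtain ⟨g, hg, rfl⟩ := (Set.mem_finsetSum _ _ _).1 hq
    exact W.sum_mem fun i hi =>
      (hWm _).2 (suppHull_subset_of_forall_eq_zero e i v (hv0 i hi) (hg hi))

end MomentMap

/-- Ryser's formula for the permanent. -/
lemma sum_neg_one_pow_mul_prod_sum {ι : Type*} [Fintype ι] [DecidableEq ι] (x : ι → ι → ℝ) :
    ∑ s ∈ (Finset.univ : Finset ι).powerset,
      (-1 : ℝ) ^ (Fintype.card ι - s.card) * ∏ j, ∑ i ∈ s, x i j =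
      ∑ π : Equiv.Perm ι, ∏ j, x (π j) j := by
  have h1 : ∀ f : ι → ι, ∑ s : Finset ι,
      (if ∀ j, f j ∈ s then (-1 : ℝ) ^ (Fintype.card ι - s.card) else 0) =
      if Function.Bijective f then 1 else 0 := by
    intro f
    have h2 : ∑ s : Finset ι, (if ∀ j, f j ∈ s then (-1 : ℝ) ^ (Fintype.card ι - s.card) else 0) =
        ∑ t ∈ (Finset.univ.image f)ᶜ.powerset, (-1 : ℝ) ^ t.card := by
      rw [← Finset.sum_filter]
      refine Finset.sum_nbij' (fun s => sᶜ) (fun s => sᶜ) ?_ ?_ (fun s _ => compl_compl s)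
        (fun s _ => compl_compl s) fun s _ => by rw [Finset.card_compl]
      · intro s hs
        rw [Finset.mem_powerset, Finset.compl_subset_compl, Finset.image_subset_iff]
        simpa using hs
      · intro t ht
        simp only [Finset.mem_filter, Finset.mem_univ, true_and, Finset.mem_compl]
        intro j hj
        have := Finset.mem_powerset.1 ht hj
        simp at this
    have h3 := Finset.sum_powerset_neg_one_pow_card (x := (Finset.univ.image f)ᶜ)
    have h4 : ∑ t ∈ (Finset.univ.image f)ᶜ.powerset, (-1 : ℝ) ^ t.card =
        if (Finset.univ.image f)ᶜ = ∅ then 1 else 0 := by exact_mod_cast h3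
    rw [h2, h4]
    congr 1
    rw [Finset.compl_eq_empty_iff, ← Finset.coe_eq_univ, Finset.coe_image, Finset.coe_univ,
      Set.image_univ, Set.range_eq_univ, ← Finite.surjective_iff_bijective]
  have h5 : ∀ s : Finset ι, (-1 : ℝ) ^ (Fintype.card ι - s.card) * ∏ j, ∑ i ∈ s, x i j =
      ∑ f : ι → ι, (if ∀ j, f j ∈ s then (-1 : ℝ) ^ (Fintype.card ι - s.card) else 0) *
        ∏ j, x (f j) j := by
    intro s
    rw [Finset.prod_univ_sum, Finset.mul_sum]
    have : Fintype.piFinset (fun _ : ι => s) =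
        Finset.univ.filter fun f : ι → ι => ∀ j, f j ∈ s := by
      ext f; simp
    rw [this, Finset.sum_filter]
    refine Finset.sum_congr rfl fun f _ => ?_
    split_ifs <;> simp
  rw [Finset.powerset_univ, Finset.sum_congr rfl fun s _ => h5 s, Finset.sum_comm]
  simp_rw [← Finset.sum_mul, h1, ite_mul, one_mul, zero_mul]
  rw [← Finset.sum_filter]
  symm
  refine Finset.sum_bij (fun π _ => (π : ι → ι)) (fun π _ => by simp)
    (fun π _ ρ _ h => DFunLike.coe_injective h) (fun f hf => ?_) fun π _ => rfl
  exact ⟨Equiv.ofBijective f (Finset.mem_filter.1 hf).2, Finset.mem_univ _, rfl⟩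

/-- Polarization of the determinant. -/
lemma sum_neg_one_pow_mul_det_sum {r : ℕ} (C : Fin r → Matrix (Fin r) (Fin r) ℝ) :
    ∑ s ∈ (Finset.univ : Finset (Fin r)).powerset,
      (-1 : ℝ) ^ (Fintype.card (Fin r) - s.card) * (∑ i ∈ s, C i).det = mixedDisc C := by
  simp_rw [Matrix.det_apply', Matrix.sum_apply, Finset.mul_sum]
  rw [Finset.sum_comm]
  have h1 : ∀ σ : Equiv.Perm (Fin r), ∑ s ∈ (Finset.univ : Finset (Fin r)).powerset,
      (-1 : ℝ) ^ (Fintype.card (Fin r) - s.card) *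
        (((Equiv.Perm.sign σ : ℤ) : ℝ) * ∏ j, ∑ i ∈ s, C i (σ j) j) =
      ∑ π : Equiv.Perm (Fin r), ((Equiv.Perm.sign σ : ℤ) : ℝ) * ∏ i, C i (σ (π i)) (π i) := by
    intro σ
    have h2 := sum_neg_one_pow_mul_prod_sum fun i j : Fin r => C i (σ j) j
    simp_rw [mul_left_comm _ (((Equiv.Perm.sign σ : ℤ) : ℝ))]
    rw [← Finset.mul_sum, h2, ← Finset.mul_sum]
    congr 1
    refine Fintype.sum_equiv (Equiv.inv _) _ _ fun π => ?_
    refine Fintype.prod_equiv π _ _ fun j => ?_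
    simp
  rw [Finset.sum_congr rfl fun σ _ => h1 σ, Finset.sum_comm, mixedDisc]
  refine .trans ?_ Finset.sum_comm
  refine Finset.sum_congr rfl fun π _ => ?_
  refine Fintype.sum_equiv (Equiv.mulRight π) _ _ fun σ => ?_
  congr 1
  have h3 : ((Equiv.Perm.sign π : ℤ) : ℝ) * ((Equiv.Perm.sign π : ℤ) : ℝ) = 1 := by
    rw [← Int.cast_mul, ← Units.val_mul, Int.units_mul_self, Units.val_one, Int.cast_one]
  rw [Equiv.coe_mulRight, Equiv.Perm.sign_mul, Units.val_mul, Int.cast_mul, mul_assoc, h3, mul_one]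

lemma mixedDisc_smul {r : ℕ} (a : ℝ) (C : Fin r → Matrix (Fin r) (Fin r) ℝ) :
    mixedDisc (fun i => a • C i) = a ^ r * mixedDisc C := by
  simp only [mixedDisc, Matrix.smul_apply, smul_eq_mul, Finset.prod_mul_distrib,
    Finset.prod_const, Finset.card_univ, Fintype.card_fin, Finset.mul_sum]
  exact Finset.sum_congr rfl fun σ _ => Finset.sum_congr rfl fun τ _ => by ring

section MomentMap

variable {r : ℕ} {K : Fin r → Type} (e : ∀ i, K i → Fin r → ℝ) [∀ i, Fintype (K i)]

lemma continuous_det_momentJac (s : Finset (Fin r)) :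
    Continuous fun x => (momentJac e s x).det := by
  have h1 : ∀ i k, Continuous (gibbsWeight e i k) := fun i k => by unfold gibbsWeight; fun_prop
  have h2 : ∀ i, Continuous (partFun e i) := fun i => by
    unfold partFun
    exact continuous_const.add (continuous_finsetSum _ fun k _ => h1 i k)
  refine Continuous.matrix_det (continuous_matrix fun j l => ?_)
  simp only [momentJac, Matrix.sum_apply, Matrix.smul_apply, covMat_apply]
  refine continuous_finsetSum _ fun i _ => Continuous.fun_const_smul (Continuous.fun_sub
    (Continuous.div ?_ (h2 i) fun x => (partFun_pos e i x).ne')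
    (Continuous.div (.fun_mul ?_ ?_) ((h2 i).fun_pow 2)
      fun x => (pow_pos (partFun_pos e i x) 2).ne')) _
  all_goals exact continuous_finsetSum _ fun k _ => continuous_const.mul (h1 i k)

lemma integrable_det_momentJac (s : Finset (Fin r)) :
    Integrable fun x => (momentJac e s x).det := by
  refine ⟨(continuous_det_momentJac e s).aestronglyMeasurable, ?_⟩
  rw [hasFiniteIntegral_iff_ofReal
    (Filter.Eventually.of_forall fun x => (posSemidef_momentJac e s x).det_nonneg),
    lintegral_det_momentJac]
  exact (isCompact_sum_suppHull e s).measure_lt_top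

lemma integral_det_momentJac (s : Finset (Fin r)) :
    ∫ x, (momentJac e s x).det = (volume (∑ i ∈ s, suppHull e i)).toReal := by
  rw [integral_eq_lintegral_of_nonneg_ae
    (Filter.Eventually.of_forall fun x => (posSemidef_momentJac e s x).det_nonneg)
    (continuous_det_momentJac e s).aestronglyMeasurable, lintegral_det_momentJac]

lemma mixedDisc_covMat_nonneg (x : Fin r → ℝ) : 0 ≤ mixedDisc fun i => covMat e i x := by
  have h1 := integral_kacRice e fun j => (x j : ℂ)
  have h2 : 0 ≤ ∫ c, kacRice e c fun j => (x j : ℂ) :=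
    integral_nonneg fun c => by unfold kacRice; positivity
  rw [h1] at h2
  exact nonneg_of_mul_nonneg_right h2 (by positivity)

lemma two_pow_mul_mixedDisc_covMat (x : Fin r → ℝ) :
    2 ^ r * mixedDisc (fun i => covMat e i x) =
      ∑ s ∈ (Finset.univ : Finset (Fin r)).powerset,
        (-1 : ℝ) ^ (Fintype.card (Fin r) - s.card) * (momentJac e s x).det := by
  rw [← mixedDisc_smul, ← sum_neg_one_pow_mul_det_sum]
  rfl

/-- The integral of the mixed discriminant of covariance matrices is a mixed volume. -/
lemma integral_mixedDisc_covMat (hr : r ≠ 0) :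
    ∫ x, 2 ^ r * mixedDisc (fun i => covMat e i x) = mixedVolume r (suppHull e) := by
  simp_rw [two_pow_mul_mixedDisc_covMat]
  rw [integral_finsetSum _ fun s _ => (integrable_det_momentJac e s).const_mul _, mixedVolume,
    if_neg hr]
  refine Finset.sum_congr rfl fun s _ => ?_
  rw [integral_const_mul, integral_det_momentJac]
  split_ifs with hs
  · rfl
  · rw [Finset.not_nonempty_iff_eq_empty] at hs
    have : Nonempty (Fin r) := ⟨⟨0, Nat.pos_of_ne_zero hr⟩⟩
    subst hs
    simp [← Set.singleton_zero]

lemma mixedVolume_suppHull_nonneg (hr : r ≠ 0) : 0 ≤ mixedVolume r (suppHull e) := by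
  rw [← integral_mixedDisc_covMat e hr]
  exact integral_nonneg fun x => mul_nonneg (by positivity) (mixedDisc_covMat_nonneg e x)

lemma lintegral_mixedDisc_covMat (hr : r ≠ 0) :
    ENNReal.ofReal (2 ^ r) * ∫⁻ x, ENNReal.ofReal (mixedDisc fun i => covMat e i x) =
      ENNReal.ofReal (mixedVolume r (suppHull e)) := by
  have h2 : Integrable fun x => 2 ^ r * mixedDisc (fun i => covMat e i x) := by
    simp_rw [two_pow_mul_mixedDisc_covMat]
    exact integrable_finsetSum _ fun s _ => (integrable_det_momentJac e s).const_mul _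
  rw [← integral_mixedDisc_covMat e hr, ofReal_integral_eq_lintegral_ofReal h2
    (Filter.Eventually.of_forall fun x => mul_nonneg (by positivity) (mixedDisc_covMat_nonneg e x)),
    ← lintegral_const_mul' _ _ ENNReal.ofReal_ne_top]
  exact lintegral_congr fun x => (ENNReal.ofReal_mul (by positivity)).symm

end MomentMap

lemma chEval_zero (ξ : Fin n → ℂˣ) : chEval ξ 0 = 1 := by simp [chEval]

lemma chEval_add (ξ : Fin n → ℂˣ) (a b : Fin n → ℤ) :
    chEval ξ (a + b) = chEval ξ a * chEval ξ b := by
  simp [chEval, zpow_add, Finset.prod_mul_distrib]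

lemma chEval_ne_zero (ξ : Fin n → ℂˣ) (a : Fin n → ℤ) : chEval ξ a ≠ 0 :=
  Finset.prod_ne_zero_iff.2 fun _ _ => Units.ne_zero _

lemma chEval_neg (ξ : Fin n → ℂˣ) (a : Fin n → ℤ) : chEval ξ (-a) = (chEval ξ a)⁻¹ := by
  simp [chEval]

lemma chEval_sub (ξ : Fin n → ℂˣ) (a b : Fin n → ℤ) :
    chEval ξ (a - b) = chEval ξ a / chEval ξ b := by
  rw [sub_eq_add_neg, chEval_add, chEval_neg, div_eq_mul_inv]

lemma chEval_mul (ξ η : Fin n → ℂˣ) (a : Fin n → ℤ) :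
    chEval (ξ * η) a = chEval ξ a * chEval η a := by
  simp [chEval, mul_zpow, Finset.prod_mul_distrib]

/-- The action of a field automorphism of `ℂ` on the torus. -/
def torusAut (φ : ℂ ≃+* ℂ) (ξ : Fin n → ℂˣ) : Fin n → ℂˣ := fun j =>
  Units.map (φ : ℂ →* ℂ) (ξ j)

lemma coe_torusAut (φ : ℂ ≃+* ℂ) (ξ : Fin n → ℂˣ) (j : Fin n) :
    (torusAut φ ξ j : ℂ) = φ (ξ j) := rfl

lemma chEval_torusAut (φ : ℂ ≃+* ℂ) (ξ : Fin n → ℂˣ) (a : Fin n → ℤ) :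
    chEval (torusAut φ ξ) a = φ (chEval ξ a) := by
  simp [chEval, map_prod, coe_torusAut]

lemma torusAut_injective (φ : ℂ ≃+* ℂ) : Function.Injective (torusAut (n := n) φ) := by
  intro ξ η h
  ext j
  exact φ.injective (by rw [← coe_torusAut, h, coe_torusAut])

/-- The common roots in the torus of the Laurent polynomials with exponents `a i` and
coefficients `c i`. -/
def sysRoots {ι : Type*} {B : ι → Type*} [∀ i, Fintype (B i)] (a : ∀ i, B i → Fin n → ℤ)
    (c : ∀ i, B i → ℂ) : Set (Fin n → ℂˣ) :=
  {y | ∀ i, ∑ b, c i b * chEval y (a i b) = 0}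

lemma torusAut_mem_sysRoots {ι : Type*} {B : ι → Type*} [∀ i, Fintype (B i)]
    (a : ∀ i, B i → Fin n → ℤ) {c c' : ∀ i, B i → ℂ} (φ : ℂ ≃+* ℂ)
    (h : ∀ i b, φ (c i b) = c' i b) {y : Fin n → ℂˣ} (hy : y ∈ sysRoots a c) :
    torusAut φ y ∈ sysRoots a c' := by
  intro i
  have := congr_arg φ (hy i)
  simpa [chEval_torusAut, h] using this

lemma encard_sysRoots_eq {ι : Type*} [Finite ι] {B : ι → Type*} [∀ i, Fintype (B i)]
    (a : ∀ i, B i → Fin n → ℤ) {c c' : ∀ i, B i → ℂ}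
    (hc : AlgebraicIndependent ℚ fun p : Σ i, B i => c p.1 p.2)
    (hc' : AlgebraicIndependent ℚ fun p : Σ i, B i => c' p.1 p.2) :
    (sysRoots a c).encard = (sysRoots a c').encard := by
  have key : ∀ {c c' : ∀ i, B i → ℂ}, AlgebraicIndependent ℚ (fun p : Σ i, B i => c p.1 p.2) →
      AlgebraicIndependent ℚ (fun p : Σ i, B i => c' p.1 p.2) →
      (sysRoots a c).encard ≤ (sysRoots a c').encard := by
    intro c c' hc hc'
    obtain ⟨φ, hφ⟩ := exists_algEquiv_of_algebraicIndependent hc hc'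
    exact Set.encard_le_encard_of_injOn
      (fun y hy => torusAut_mem_sysRoots a φ.toRingEquiv (fun i b => hφ ⟨i, b⟩) hy)
      (torusAut_injective _).injOn
  exact le_antisymm (key hc hc') (key hc' hc)

section Strip

variable {r : ℕ}

/-- The exponential map onto the torus. -/
def torusExp (z : Fin r → ℂ) : Fin r → ℂˣ := fun j =>
  Units.mk0 (Complex.exp (z j)) (Complex.exp_ne_zero _)

lemma bijOn_torusExp : Set.BijOn (torusExp (r := r)) (expStrip r) Set.univ := by
  refine ⟨fun _ _ => trivial, fun z hz w hw h => ?_, fun y _ => ?_⟩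
  · ext j
    have := congr_arg Units.val (congr_fun h j)
    exact Complex.exp_inj_of_neg_pi_lt_of_le_pi (hz j).1 (hz j).2 (hw j).1 (hw j).2 this
  · refine ⟨fun j => Complex.log (y j), fun j => ⟨?_, ?_⟩, ?_⟩
    · rw [Complex.log_im]; exact Complex.neg_pi_lt_arg _
    · rw [Complex.log_im]; exact Complex.arg_le_pi _
    · ext j
      exact Complex.exp_log (y j).ne_zero

lemma chEval_torusExp (z : Fin r → ℂ) (a : Fin r → ℤ) :
    chEval (torusExp z) a = Complex.exp (∑ j, (a j : ℂ) * z j) := by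
  rw [Complex.exp_sum, chEval]
  refine Finset.prod_congr rfl fun j _ => ?_
  rw [Units.val_zpow_eq_zpow_val, Complex.exp_int_mul]
  rfl

end Strip

lemma mixedVolume_singleton_add {r : ℕ} (v : Fin r → Fin r → ℝ) (Q : Fin r → Set (Fin r → ℝ)) :
    mixedVolume r (fun i => {v i} + Q i) = mixedVolume r Q := by
  unfold mixedVolume
  congr 1
  refine Finset.sum_congr rfl fun s _ => ?_
  rw [Finset.sum_add_distrib, Set.finsetSum_singleton, Set.singleton_add, Set.image_add_left,
    measure_preimage_add]

/-- **Bernstein's theorem** for algebraically independent coefficients. -/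
theorem ncard_sysRoots {r : ℕ} {B : Fin r → Type} [∀ i, Fintype (B i)] [∀ i, Nonempty (B i)]
    (a : ∀ i, B i → Fin r → ℤ) {c : ∀ i, B i → ℂ}
    (hc : AlgebraicIndependent ℚ fun p : Σ i, B i => c p.1 p.2) :
    (sysRoots a c).Finite ∧ ((sysRoots a c).ncard : ℝ) =
      mixedVolume r fun i => convexHull ℝ (Set.range fun b => castR r (a i b)) := by
  classical
  rcases Nat.eq_zero_or_pos r with rfl | hr
  · have : sysRoots a c = Set.univ := Set.eq_univ_of_forall fun y i => i.elim0
    refine ⟨Set.toFinite _, ?_⟩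
    rw [this, Set.ncard_univ]
    simp [mixedVolume]
  let piv : ∀ i, B i := fun i => Classical.arbitrary (B i)
  let K : Fin r → Type := fun i => {b : B i // b ≠ piv i}
  let e : ∀ i, K i → Fin r → ℝ := fun i k => castR r (a i k.1) - castR r (a i (piv i))
  have hN : ∀ᵐ d : ∀ i, K i → ℂ, ∀ᵐ b : Fin r → ℂ,
      Measure.count {z ∈ expStrip r | expSys e d z = b} = ((sysRoots a c).encard : ENNReal) := by
    refine (ae_ae_algebraicIndependent r K).mono fun d hd => hd.mono fun b hb => ?_
    let c' : ∀ i, B i → ℂ := fun i x => if h : x = piv i then b i else d i ⟨x, h⟩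
    let f : (Σ i, B i) → (Σ i, K i) ⊕ Fin r :=
      fun p => if h : p.2 = piv p.1 then Sum.inr p.1 else Sum.inl ⟨p.1, p.2, h⟩
    have hf : Function.Injective f := by
      rintro ⟨i, x⟩ ⟨j, y⟩ h
      simp only [f] at h
      split_ifs at h with h1 h2 h2
      · obtain rfl := Sum.inr_injective h
        rw [h1, h2]
      · have := Sum.inl_injective h
        simp only [Sigma.mk.injEq] at this
        obtain ⟨rfl, h3⟩ := this
        exact congr_arg (Sigma.mk i) (congr_arg Subtype.val (eq_of_heq h3))
    have hc' : AlgebraicIndependent ℚ fun p : Σ i, B i => c' p.1 p.2 := by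
      convert hb.comp f hf using 1
      ext p
      simp only [c', f, Function.comp_apply]
      split_ifs <;> rfl
    rw [encard_sysRoots_eq a hc hc', Measure.count_apply]
    · congr 1
      suffices h : Set.BijOn torusExp {z ∈ expStrip r | expSys e d z = b} (sysRoots a c') by
        rw [← h.image_eq, h.injOn.encard_image]
      have hroot : ∀ z, torusExp z ∈ sysRoots a c' ↔ expSys e d z = b := by
        intro z
        rw [sysRoots, Set.mem_ofPred_eq, funext_iff]
        refine forall_congr' fun i => ?_
        have h1 : ∑ x, c' i x * chEval (torusExp z) (a i x) =
            chEval (torusExp z) (a i (piv i)) * (b i - expSys e d z i) := by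
          rw [Fintype.sum_eq_add_sum_subtype_ne _ (piv i), expSys, sub_neg_eq_add, mul_add,
            Finset.mul_sum]
          congr 1
          · simp [c', mul_comm]
          · refine Finset.sum_congr rfl fun k _ => ?_
            have h2 : chEval (torusExp z) (a i k.1) =
                chEval (torusExp z) (a i (piv i)) * expMon e i k z := by
              rw [chEval_torusExp, chEval_torusExp, expMon, ← Complex.exp_add,
                ← Finset.sum_add_distrib]
              congr 1
              refine Finset.sum_congr rfl fun j _ => ?_
              simp only [e, castR, Pi.sub_apply]
              push_cast
              ring
            simp only [c', dif_neg k.2, h2]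
            ring
        rw [h1, mul_eq_zero, or_iff_right (chEval_ne_zero _ _), sub_eq_zero, eq_comm]
      refine ⟨fun z hz => (hroot z).2 hz.2, bijOn_torusExp.injOn.mono fun z hz => hz.1,
        fun y hy => ?_⟩
      obtain ⟨z, hz, rfl⟩ := bijOn_torusExp.surjOn (Set.mem_univ y)
      exact ⟨z, ⟨hz, (hroot z).1 hy⟩, rfl⟩
    · refine (measurableSet_expStrip r).inter (measurableSet_eq_fun ?_ measurable_const)
      exact (continuous_iff_continuousAt.2 fun z =>
        (hasStrictFDerivAt_expSys e d z).hasFDerivAt.continuousAt).measurable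
  have hMV : mixedVolume r (suppHull e) =
      mixedVolume r fun i => convexHull ℝ (Set.range fun b => castR r (a i b)) := by
    rw [← mixedVolume_singleton_add (fun i => castR r (a i (piv i))) (suppHull e)]
    congr 1
    ext1 i
    rw [suppHull, ← convexHull_singleton (𝕜 := ℝ) (castR r (a i (piv i))), ← convexHull_add]
    congr 1
    rw [Set.singleton_add]
    ext q
    simp only [Set.mem_image, Set.mem_insert_iff, Set.mem_range, exists_eq_or_imp, add_zero,
      exists_exists_eq_and, e, add_sub_cancel]
    constructor
    · rintro (rfl | ⟨k, rfl⟩)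
      exacts [⟨_, rfl⟩, ⟨_, rfl⟩]
    · rintro ⟨x, rfl⟩
      by_cases h : x = piv i
      · exact Or.inl (by rw [h])
      · exact Or.inr ⟨⟨x, h⟩, rfl⟩
  have hcount := (count_eq_lintegral_mixedDisc e _ hN).trans (lintegral_mixedDisc_covMat e hr.ne')
  have hfin : (sysRoots a c).Finite := by
    rw [← Set.encard_ne_top_iff]
    intro h
    rw [h] at hcount
    exact ENNReal.ofReal_ne_top hcount.symm
  refine ⟨hfin, ?_⟩
  rw [← hMV, ← ENNReal.toReal_ofReal (mixedVolume_suppHull_nonneg e hr.ne'), ← hcount,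
    ← hfin.cast_ncard_eq]
  simp

lemma chEval_single (ξ : Fin n → ℂˣ) (j : Fin n) : chEval ξ (Pi.single j 1) = ξ j := by
  rw [chEval, Finset.prod_eq_single j]
  · simp
  · intro k _ hk
    simp [hk]
  · simp

lemma chEval_injective : Function.Injective (chEval (n := n)) := by
  intro ξ η h
  ext j
  rw [← chEval_single, h, chEval_single]

/-- Every character of `ℤ^n` is the evaluation at a point of the torus. -/
lemma exists_chEval_eq (F : (Fin n → ℤ) → ℂ) (h0 : F 0 = 1) (hadd : ∀ x y, F (x + y) = F x * F y) :
    ∃ ξ : Fin n → ℂˣ, chEval ξ = F := by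
  have hne : ∀ x, F x ≠ 0 := fun x h => by
    have := hadd x (-x)
    rw [add_neg_cancel, h0, h, zero_mul] at this
    exact one_ne_zero this
  let ξ : Fin n → ℂˣ := fun j => Units.mk0 (F (Pi.single j 1)) (hne _)
  let G : (Fin n → ℤ) →+ Additive ℂˣ :=
    { toFun := fun x => Additive.ofMul (Units.mk0 (F x) (hne x))
      map_zero' := by simp [h0]
      map_add' := fun x y => congr_arg Additive.ofMul (Units.ext (hadd x y)) }
  let H : (Fin n → ℤ) →+ Additive ℂˣ :=
    { toFun := fun x => Additive.ofMul (Units.mk0 (chEval ξ x) (chEval_ne_zero _ _))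
      map_zero' := by simp [chEval_zero]
      map_add' := fun x y => congr_arg Additive.ofMul (Units.ext (chEval_add ξ x y)) }
  have hGH : H = G := by
    ext j
    simp [G, H, chEval_single, ξ]
  refine ⟨ξ, funext fun x => ?_⟩
  exact congr_arg (fun u : Additive ℂˣ => (u.toMul : ℂ)) (DFunLike.congr_fun hGH x)

lemma chEval_mem_algCl {S : Set ℂ} {ξ : Fin n → ℂˣ} (h : ∀ j, (ξ j : ℂ) ∈ algCl S)
    (x : Fin n → ℤ) : chEval ξ x ∈ algCl S := by
  refine prod_mem fun j _ => ?_
  rw [Units.val_zpow_eq_zpow_val]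
  exact zpow_mem (h j) _

section Glue

variable {m r : ℕ} (Ψ : (Fin n → ℤ) ≃ₗ[ℤ] (Fin m → ℤ) × (Fin r → ℤ))

/-- The point of the torus with prescribed coordinates with respect to a splitting of the
character lattice. -/
def torusGlue (u : Fin m → ℂˣ) (y : Fin r → ℂˣ) : Fin n → ℂˣ := fun j =>
  Units.mk0 (chEval u (Ψ (Pi.single j 1)).1 * chEval y (Ψ (Pi.single j 1)).2)
    (mul_ne_zero (chEval_ne_zero _ _) (chEval_ne_zero _ _))

lemma chEval_torusGlue (u : Fin m → ℂˣ) (y : Fin r → ℂˣ) (x : Fin n → ℤ) :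
    chEval (torusGlue Ψ u y) x = chEval u (Ψ x).1 * chEval y (Ψ x).2 := by
  obtain ⟨ξ, hξ⟩ := exists_chEval_eq (fun x => chEval u (Ψ x).1 * chEval y (Ψ x).2)
    (by simp [chEval_zero]) fun x z => by
      simp only [map_add, Prod.fst_add, Prod.snd_add, chEval_add]
      ring
  have : torusGlue Ψ u y = ξ := by
    ext j
    rw [← chEval_single ξ, hξ, torusGlue, Units.val_mk0]
  rw [this, hξ]

lemma chEval_torusGlue_inl (u : Fin m → ℂˣ) (y : Fin r → ℂˣ) (x : Fin m → ℤ) :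
    chEval (torusGlue Ψ u y) (Ψ.symm (x, 0)) = chEval u x := by
  simp [chEval_torusGlue, chEval_zero]

lemma chEval_torusGlue_inr (u : Fin m → ℂˣ) (y : Fin r → ℂˣ) (x : Fin r → ℤ) :
    chEval (torusGlue Ψ u y) (Ψ.symm (0, x)) = chEval y x := by
  simp [chEval_torusGlue, chEval_zero]

lemma torusGlue_inj {u u' : Fin m → ℂˣ} {y y' : Fin r → ℂˣ} :
    torusGlue Ψ u y = torusGlue Ψ u' y' ↔ u = u' ∧ y = y' := by
  refine ⟨fun h => ⟨chEval_injective (funext fun x => ?_), chEval_injective (funext fun x => ?_)⟩,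
    fun h => by rw [h.1, h.2]⟩
  · rw [← chEval_torusGlue_inl Ψ u y, h, chEval_torusGlue_inl]
  · rw [← chEval_torusGlue_inr Ψ u y, h, chEval_torusGlue_inr]

lemma exists_torusGlue_eq (ξ : Fin n → ℂˣ) : ∃ u y, torusGlue Ψ u y = ξ := by
  obtain ⟨u, hu⟩ := exists_chEval_eq (fun x : Fin m → ℤ => chEval ξ (Ψ.symm (x, 0)))
    (by rw [← Prod.zero_eq_mk, map_zero, chEval_zero])
    fun x z => by rw [← chEval_add, ← map_add, Prod.mk_add_mk, add_zero]
  obtain ⟨y, hy⟩ := exists_chEval_eq (fun x : Fin r → ℤ => chEval ξ (Ψ.symm (0, x)))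
    (by rw [← Prod.zero_eq_mk, map_zero, chEval_zero])
    fun x z => by rw [← chEval_add, ← map_add, Prod.mk_add_mk, add_zero]
  refine ⟨u, y, chEval_injective (funext fun x => ?_)⟩
  rw [chEval_torusGlue, hu, hy, ← chEval_add, ← map_add, Prod.mk_add_mk, add_zero, zero_add]
  simp

lemma torusAut_torusGlue (φ : ℂ ≃+* ℂ) (u : Fin m → ℂˣ) (y : Fin r → ℂˣ) :
    torusAut φ (torusGlue Ψ u y) = torusGlue Ψ (torusAut φ u) (torusAut φ y) := by
  refine chEval_injective (funext fun x => ?_)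
  simp only [chEval_torusAut, chEval_torusGlue, map_mul]

variable {ι : Type*} {B : ι → Type*} [∀ i, Fintype (B i)] (q : ∀ i, B i → Fin n → ℤ)
  (c : ∀ i, B i → ℂ)

lemma torusGlue_mem_sysRoots {u : Fin m → ℂˣ} {y : Fin r → ℂˣ} :
    torusGlue Ψ u y ∈ sysRoots q c ↔
      y ∈ sysRoots (fun i b => (Ψ (q i b)).2) fun i b => c i b * chEval u (Ψ (q i b)).1 := by
  refine forall_congr' fun i => ?_
  simp only [chEval_torusGlue, mul_assoc]

variable {q c}

lemma sysRoots_pivot {ξ : Fin n → ℂˣ} (hξ : ξ ∈ sysRoots q c) (i : ι) (b : B i)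
    [DecidableEq (B i)] :
    c i b = -(∑ k : {k // k ≠ b}, c i k * chEval ξ (q i k)) / chEval ξ (q i b) := by
  have := hξ i
  rw [Fintype.sum_eq_add_sum_subtype_ne _ b] at this
  rw [eq_div_iff (chEval_ne_zero _ _), eq_neg_iff_add_eq_zero, this]

/-- If the non-pivot coefficients and a root are algebraic over `S`, so are all the
coefficients. -/
lemma coeff_mem_algCl {S : Set ℂ} {ξ : Fin n → ℂˣ} (hξ : ξ ∈ sysRoots q c) (piv : ∀ i, B i)
    (h1 : ∀ j, (ξ j : ℂ) ∈ algCl S) (h2 : ∀ i b, b ≠ piv i → c i b ∈ algCl S) (i : ι) (b : B i) :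
    c i b ∈ algCl S := by
  classical
  by_cases hb : b = piv i
  · rw [sysRoots_pivot hξ i b]
    subst hb
    exact div_mem (neg_mem (sum_mem fun k _ => mul_mem (h2 _ _ k.2) (chEval_mem_algCl h1 _)))
      (chEval_mem_algCl h1 _)
  · exact h2 i b hb

end Glue

section Exchange

variable {m r : ℕ} (Ψ : (Fin n → ℤ) ≃ₗ[ℤ] (Fin m → ℤ) × (Fin r → ℤ))
  {ι : Type} {B : ι → Type} (q : ∀ i, B i → Fin n → ℤ)

/-- The coordinates of a point of the torus together with the non-pivot coefficients. -/
def rootParam (piv : ∀ i, B i) (ξ : Fin n → ℂˣ) (c : ∀ i, B i → ℂ) :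
    Fin n ⊕ (Σ i, {b : B i // b ≠ piv i}) → ℂ :=
  Sum.elim (fun j => (ξ j : ℂ)) fun k => c k.1 k.2

/-- The coefficients of the system obtained by substituting `u` for the first block of
coordinates. -/
def redCoeff (c : ∀ i, B i → ℂ) (u : Fin m → ℂˣ) (i : ι) (b : B i) : ℂ :=
  c i b * chEval u (Ψ (q i b)).1

/-- The coefficients of the reduced system, together with the substituted coordinates. -/
def redParam (c : ∀ i, B i → ℂ) (u : Fin m → ℂˣ) : (Σ i, B i) ⊕ Fin m → ℂ :=
  Sum.elim (fun k => redCoeff Ψ q c u k.1 k.2) fun t => (u t : ℂ)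

variable {Ψ q} {c : ∀ i, B i → ℂ} {u : Fin m → ℂˣ} {y : Fin r → ℂˣ} (piv : ∀ i, B i)

lemma rootParam_inr_mem_algCl (k : Σ i, {b : B i // b ≠ piv i}) (ξ : Fin n → ℂˣ) :
    rootParam piv ξ c (Sum.inr k) ∈ algCl (Set.range (redParam Ψ q c u)) := by
  have h0 : ∀ t, (u t : ℂ) ∈ algCl (Set.range (redParam Ψ q c u)) := fun t =>
    subset_algCl _ ⟨Sum.inr t, rfl⟩
  have h1 : ∀ x, chEval u x ∈ algCl (Set.range (redParam Ψ q c u)) := chEval_mem_algCl h0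
  have h2 : redCoeff Ψ q c u k.1 k.2 ∈ algCl (Set.range (redParam Ψ q c u)) :=
    subset_algCl _ ⟨Sum.inl ⟨k.1, k.2.1⟩, rfl⟩
  have := div_mem h2 (h1 (Ψ (q k.1 k.2)).1)
  rwa [redCoeff, mul_div_cancel_right₀ _ (chEval_ne_zero _ _)] at this

variable [∀ i, Fintype (B i)]

lemma redParam_mem_algCl (h : torusGlue Ψ u y ∈ sysRoots q c) (k : (Σ i, B i) ⊕ Fin m) :
    redParam Ψ q c u k ∈ algCl (Set.range (rootParam piv (torusGlue Ψ u y) c)) := by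
  have h1 : ∀ j, (torusGlue Ψ u y j : ℂ) ∈
      algCl (Set.range (rootParam piv (torusGlue Ψ u y) c)) := fun j =>
    subset_algCl _ ⟨Sum.inl j, rfl⟩
  have h2 : ∀ x, chEval u x ∈ algCl (Set.range (rootParam piv (torusGlue Ψ u y) c)) := fun x => by
    rw [← chEval_torusGlue_inl Ψ u y]
    exact chEval_mem_algCl h1 _
  rcases k with ⟨i, b⟩ | t
  · exact mul_mem (coeff_mem_algCl h piv h1
      (fun i b hb => subset_algCl _ ⟨Sum.inr ⟨i, b, hb⟩, rfl⟩) i b) (h2 _)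
  · have := h2 (Pi.single t 1)
    rwa [chEval_single] at this

variable [Fintype ι]

lemma card_rootParam [∀ i, DecidableEq (B i)] (h : Fintype.card ι + m = n) :
    Fintype.card (Fin n ⊕ (Σ i, {b : B i // b ≠ piv i})) =
      Fintype.card ((Σ i, B i) ⊕ Fin m) := by
  have h1 : ∀ i, Fintype.card (B i) = Fintype.card {b : B i // b ≠ piv i} + 1 := fun i => by
    have : 0 < Fintype.card (B i) := Fintype.card_pos_iff.2 ⟨piv i⟩
    rw [Fintype.card_subtype_compl, Fintype.card_subtype_eq]
    omega
  simp only [Fintype.card_sum, Fintype.card_sigma, Fintype.card_fin]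
  rw [Finset.sum_congr rfl fun i _ => h1 i, Finset.sum_add_distrib]
  simp only [Finset.sum_const, Finset.card_univ, smul_eq_mul, mul_one]
  omega

/-- If the reduced system with generic coefficients is solvable, then the parameters of a
reduction of a generic solvable system are generic. -/
lemma algebraicIndependent_redParam (hcard : Fintype.card ι + m = n)
    (h : torusGlue Ψ u y ∈ sysRoots q c)
    (hX : AlgebraicIndependent ℚ (rootParam piv (torusGlue Ψ u y) c))
    {e : ∀ i, B i → ℂ} {v : Fin m → ℂ}
    (he : AlgebraicIndependent ℚ (Sum.elim (fun k : Σ i, B i => e k.1 k.2) v))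
    (hne : (sysRoots (fun i b => (Ψ (q i b)).2) e).Nonempty) :
    AlgebraicIndependent ℚ (redParam Ψ q c u) := by
  classical
  obtain ⟨z, hz⟩ := hne
  let w : Fin m → ℂˣ := fun t => Units.mk0 (v t) (he.ne_zero (Sum.inr t))
  let c' : ∀ i, B i → ℂ := fun i b => e i b / chEval w (Ψ (q i b)).1
  have hc' : redCoeff Ψ q c' w = e := by
    ext i b
    rw [redCoeff, div_mul_cancel₀ _ (chEval_ne_zero _ _)]
  have h' : torusGlue Ψ w z ∈ sysRoots q c' := by
    rw [torusGlue_mem_sysRoots]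
    change z ∈ sysRoots _ (redCoeff Ψ q c' w)
    rwa [hc']
  have hred : redParam Ψ q c' w = Sum.elim (fun k : Σ i, B i => e k.1 k.2) v := by
    rw [redParam, hc']
    rfl
  rw [← hred] at he
  have hX' : AlgebraicIndependent ℚ (rootParam piv (torusGlue Ψ w z) c') :=
    he.of_mem_algCl (redParam_mem_algCl piv h') (card_rootParam piv hcard).le
  obtain ⟨φ, hφ⟩ := exists_algEquiv_of_algebraicIndependent hX' hX
  have h1 : torusAut φ.toRingEquiv (torusGlue Ψ w z) = torusGlue Ψ u y := by
    ext j
    exact hφ (Sum.inl j)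
  have h2 : torusAut φ.toRingEquiv w = u := by
    rw [torusAut_torusGlue, torusGlue_inj] at h1
    exact h1.1
  have h3 : ∀ x, φ (chEval (torusGlue Ψ w z) x) = chEval (torusGlue Ψ u y) x := fun x => by
    rw [← h1, chEval_torusAut]
    rfl
  have h4 : ∀ i b, φ (c' i b) = c i b := by
    intro i b
    by_cases hb : b = piv i
    · rw [sysRoots_pivot h' i b, sysRoots_pivot h i b, map_div₀, map_neg, map_sum, h3]
      congr 2
      refine Finset.sum_congr rfl fun k _ => ?_
      subst hb
      rw [map_mul, h3]
      congr 1
      exact hφ (Sum.inr ⟨i, k⟩)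
    · exact hφ (Sum.inr ⟨i, b, hb⟩)
  convert he.map' (f := φ.toAlgHom) φ.injective using 1
  ext k
  rcases k with ⟨i, b⟩ | t
  · change redCoeff Ψ q c u i b = φ (redCoeff Ψ q c' w i b)
    rw [redCoeff, redCoeff, map_mul, h4, ← h2, chEval_torusAut]
    rfl
  · rw [← h2]
    rfl

/-- Twisting by roots of unity preserves genericity. -/
lemma algebraicIndependent_redCoeff_mul
    (h : AlgebraicIndependent ℚ (redParam Ψ q c u)) {ζ : Fin m → ℂˣ}
    (hζ : ∀ x, ∃ N : ℕ, 0 < N ∧ chEval ζ x ^ N = 1) :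
    AlgebraicIndependent ℚ fun k : Σ i, B i => redCoeff Ψ q c (ζ * u) k.1 k.2 := by
  have hind : AlgebraicIndependent ℚ
      (Sum.elim (fun k : Σ i, B i => redCoeff Ψ q c (ζ * u) k.1 k.2) fun t => (u t : ℂ)) := by
    refine h.of_mem_algCl ?_ le_rfl
    set S := Set.range
      (Sum.elim (fun k : Σ i, B i => redCoeff Ψ q c (ζ * u) k.1 k.2) fun t => (u t : ℂ)) with hS
    rintro (⟨i, b⟩ | t)
    · have h1 : redCoeff Ψ q c (ζ * u) i b ∈ algCl S := subset_algCl _ ⟨Sum.inl ⟨i, b⟩, rfl⟩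
      obtain ⟨N, hN, hN1⟩ := hζ (Ψ (q i b)).1
      have h2 : chEval ζ (Ψ (q i b)).1 ∈ algCl S :=
        mem_algCl_of_pow hN (by rw [hN1]; exact one_mem _)
      have := div_mem h1 h2
      rwa [redCoeff, chEval_mul, mul_left_comm, mul_div_cancel_left₀ _ (chEval_ne_zero _ _)]
        at this
    · exact subset_algCl _ ⟨Sum.inr t, rfl⟩
  exact hind.comp Sum.inl Sum.inl_injective

/-- A generic solvable system whose reduction is not generic has infinitely many roots. -/
lemma exists_infinite_torusAut (hcard : Fintype.card ι + m = n)
    (hX : AlgebraicIndependent ℚ (rootParam piv (torusGlue Ψ u y) c))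
    (hred : ¬ AlgebraicIndependent ℚ (redParam Ψ q c u)) :
    {η | ∃ φ : ℂ ≃+* ℂ, (∀ i b, φ (c i b) = c i b) ∧ torusAut φ u = u ∧
      torusAut φ (torusGlue Ψ u y) = η}.Infinite := by
  classical
  obtain ⟨j, hj⟩ : ∃ j, (torusGlue Ψ u y j : ℂ) ∉ algCl (Set.range (redParam Ψ q c u)) := by
    by_contra! hall
    refine hred (hX.of_mem_algCl ?_ (card_rootParam piv hcard).ge)
    rintro (j | k)
    exacts [hall j, rootParam_inr_mem_algCl piv k _]
  refine Set.Infinite.of_image (fun η => (η j : ℂ))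
    ((infinite_orbit_of_notMem_algCl (Set.finite_range _) hj).mono ?_)
  rintro _ ⟨φ, hφ, rfl⟩
  have hu : torusAut φ u = u := by
    ext t
    exact hφ _ ⟨Sum.inr t, rfl⟩
  refine ⟨_, ⟨φ, fun i b => ?_, hu, rfl⟩, rfl⟩
  have := hφ _ ⟨Sum.inl ⟨i, b⟩, rfl⟩
  change φ (redCoeff Ψ q c u i b) = redCoeff Ψ q c u i b at this
  rw [redCoeff, map_mul, ← chEval_torusAut, hu] at this
  exact mul_right_cancel₀ (chEval_ne_zero _ _) this

end Exchange

lemma finrank_comap_subtype {M : Type*} [AddCommGroup M] {N L : Submodule ℤ M} (h : N ≤ L) :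
    Module.finrank ℤ (N.comap L.subtype) = Module.finrank ℤ N :=
  (Submodule.comapSubtypeEquivOfLe h).finrank_eq

/-- Modulo torsion, a lattice is generated over a sublattice by as many elements as the
difference of ranks. -/
lemma exists_smul_mem_sup_span {M : Type*} [AddCommGroup M] [Module.Finite ℤ M]
    (N : Submodule ℤ M) :
    ∃ b : Fin (Module.finrank ℤ M - Module.finrank ℤ N) → M, ∀ x, ∃ k : ℤ, k ≠ 0 ∧
      k • x ∈ N ⊔ Submodule.span ℤ (Set.range b) := by
  have hrank := N.finrank_quotient_add_finrank
  have hle : Module.finrank ℤ M - Module.finrank ℤ N ≤ Module.finrank ℤ (M ⧸ N) := by omega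
  obtain ⟨f, hf⟩ := exists_linearIndependent_of_le_finrank hle
  choose b hb using fun i => Submodule.Quotient.mk_surjective N (f i)
  refine ⟨b, fun x => ?_⟩
  have h0 : Module.finrank ℤ ((M ⧸ N) ⧸ Submodule.span ℤ (Set.range f)) = 0 := by
    have h1 := (Submodule.span ℤ (Set.range f)).finrank_quotient_add_finrank
    rw [finrank_span_eq_card hf, Fintype.card_fin] at h1
    omega
  obtain ⟨k, hk, hkx⟩ := Module.finrank_eq_zero_iff.1 h0 (Submodule.Quotient.mk (N.mkQ x))
  refine ⟨k, hk, ?_⟩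
  rw [← Submodule.Quotient.mk_smul, Submodule.Quotient.mk_eq_zero, ← map_smul] at hkx
  have hf' : Set.range f = N.mkQ '' Set.range b := by
    rw [← Set.range_comp]
    exact congr_arg Set.range (funext fun i => (hb i).symm)
  rw [hf', ← Submodule.map_span] at hkx
  obtain ⟨z, hz, hzx⟩ := hkx
  have : k • x - z ∈ N := by
    rw [← Submodule.Quotient.mk_eq_zero, Submodule.Quotient.mk_sub, sub_eq_zero]
    exact hzx.symm
  rw [← sub_add_cancel (k • x) z]
  exact Submodule.add_mem_sup this hz

lemma chEval_zsmul (ξ : Fin n → ℂˣ) (k : ℤ) (x : Fin n → ℤ) :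
    chEval ξ (k • x) = chEval ξ x ^ k := by
  simp only [chEval, ← Finset.prod_zpow, Units.val_zpow_eq_zpow_val, Pi.smul_apply, smul_eq_mul]
  exact Finset.prod_congr rfl fun j _ => by rw [mul_comm, zpow_mul]

/-- The characters trivial at a point of the torus. -/
def chKer (θ : Fin n → ℂˣ) : Submodule ℤ (Fin n → ℤ) where
  carrier := {x | chEval θ x = 1}
  zero_mem' := chEval_zero θ
  add_mem' {x y} hx hy := by
    rw [Set.mem_ofPred_eq] at hx hy ⊢
    rw [chEval_add, hx, hy, mul_one]
  smul_mem' k x hx := by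
    rw [Set.mem_ofPred_eq] at hx ⊢
    rw [chEval_zsmul, hx, one_zpow]

lemma mem_chKer {θ : Fin n → ℂˣ} {x : Fin n → ℤ} : x ∈ chKer θ ↔ chEval θ x = 1 := Iff.rfl

lemma Submodule.finset_sum_le_iff {M κ : Type*} [AddCommGroup M] (s : Finset κ)
    (D : κ → Submodule ℤ M) (N : Submodule ℤ M) :
    ∑ j ∈ s, D j ≤ N ↔ ∀ j ∈ s, D j ≤ N := by
  classical
  induction s using Finset.induction_on with
  | empty => simp
  | insert a s ha ih => simp [Finset.sum_insert ha, ih]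

lemma diffLattice_le_iff {M : Type*} [AddCommGroup M] {A : Finset M} {a : M} (ha : a ∈ A)
    {N : Submodule ℤ M} : diffLattice A ≤ N ↔ ∀ b ∈ A, b - a ∈ N := by
  refine ⟨fun h b hb => h (Submodule.subset_span ⟨b, hb, a, ha, rfl⟩), fun h => ?_⟩
  refine Submodule.span_le.2 ?_
  rintro _ ⟨b, hb, d, hd, rfl⟩
  rw [← sub_sub_sub_cancel_right b d a]
  exact N.sub_mem (h b hb) (h d hd)

/-- Two common roots of a generic solvable system agree on the lattice of an essential
subfamily. -/
theorem lattice_le_chKer {κ : Type} [Fintype κ] {A : κ → Finset (Fin n → ℤ)} {J : Finset κ}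
    (hess : IsEssential A J) (piv : ∀ i, {a // a ∈ A i}) {c : ∀ i, {a // a ∈ A i} → ℂ}
    {ξ η : Fin n → ℂˣ} (hξ : ξ ∈ sysRoots (fun i (b : {a // a ∈ A i}) => b.1) c)
    (hη : η ∈ sysRoots (fun i (b : {a // a ∈ A i}) => b.1) c)
    (hX : AlgebraicIndependent ℚ (rootParam piv ξ c)) :
    ∑ j ∈ J, diffLattice (A j) ≤ chKer (ξ⁻¹ * η) := by
  classical
  set θ := ξ⁻¹ * η with hθ
  have hηθ : η = ξ * θ := by rw [hθ, mul_inv_cancel_left]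
  set L := ∑ j ∈ J, diffLattice (A j) with hL
  let T := J.filter fun k => diffLattice (A k) ≤ chKer θ
  by_contra hcon
  have hTJ : T ⊂ J := by
    refine (Finset.filter_ssubset).2 ?_
    rw [hL, Submodule.finset_sum_le_iff] at hcon
    push Not at hcon
    exact hcon
  have hTcard := hess.2 T hTJ
  set LT := ∑ j ∈ T, diffLattice (A j) with hLT
  have hLTker : LT ≤ chKer θ :=
    (Submodule.finset_sum_le_iff _ _ _).2 fun j hj => (Finset.mem_filter.1 hj).2
  have hDL : ∀ j ∈ J, diffLattice (A j) ≤ L := (Submodule.finset_sum_le_iff _ _ _).1 le_rfl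
  have hLTL : LT ≤ L :=
    (Submodule.finset_sum_le_iff _ _ _).2 fun j hj => hDL j (Finset.mem_filter.1 hj).1
  have hex := exists_smul_mem_sup_span (LT.comap L.subtype)
  rw [finrank_comap_subtype hLTL] at hex
  obtain ⟨b, hb⟩ := hex
  have hstar : ∀ k : {k // k ∈ J \ T}, ∃ a : {a // a ∈ A k.1}, a ≠ piv k ∧
      chEval θ (a.1 - (piv k).1) ≠ 1 := by
    rintro ⟨k, hk⟩
    rw [Finset.mem_sdiff, Finset.mem_filter, not_and] at hk
    have h1 := hk.2 hk.1
    rw [diffLattice_le_iff (piv k).2] at h1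
    push Not at h1
    obtain ⟨a, ha, ha1⟩ := h1
    refine ⟨⟨a, ha⟩, fun h => ha1 ?_, ha1⟩
    rw [← h, sub_self]
    exact zero_mem _
  choose st hst1 hst2 using hstar
  let star : {k // k ∈ J \ T} → Σ i, {b : {a // a ∈ A i} // b ≠ piv i} :=
    fun k => ⟨k.1, st k, hst1 k⟩
  have hinj : Function.Injective star := fun k l h => Subtype.ext (congr_arg Sigma.fst h)
  let s : Fin n ⊕ (Fin (Module.finrank ℤ L - Module.finrank ℤ LT) ⊕ {k // k ∉ Set.range star}) →
      ℂ := Sum.elim (fun j => (ξ j : ℂ)) (Sum.elim (fun t => chEval θ (b t)) fun k => c k.1.1 k.1.2)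
  set S := Set.range s with hS
  have hξS : ∀ x, chEval ξ x ∈ algCl S :=
    chEval_mem_algCl fun j => subset_algCl _ ⟨Sum.inl j, rfl⟩
  have hspan : ∀ x ∈ Submodule.span ℤ (Set.range b), chEval θ (x : Fin n → ℤ) ∈ algCl S := by
    intro x hx
    induction hx using Submodule.span_induction with
    | mem x hx =>
      obtain ⟨t, rfl⟩ := hx
      exact subset_algCl _ ⟨Sum.inr (Sum.inl t), rfl⟩
    | zero => rw [Submodule.coe_zero, chEval_zero]; exact one_mem _
    | add x y _ _ hx hy => rw [Submodule.coe_add, chEval_add]; exact mul_mem hx hy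
    | smul k x _ hx => rw [Submodule.coe_smul, chEval_zsmul]; exact zpow_mem hx k
  have hθS : ∀ x ∈ L, chEval θ x ∈ algCl S := by
    intro x hx
    obtain ⟨k, hk, hkx⟩ := hb ⟨x, hx⟩
    obtain ⟨y, hy, z, hz, hyz⟩ := Submodule.mem_sup.1 hkx
    refine mem_algCl_of_zpow hk ?_
    have h1 : k • x = (y : Fin n → ℤ) + z := congr_arg Subtype.val hyz.symm
    have h2 : chEval θ (y : Fin n → ℤ) = 1 := hLTker hy
    rw [← chEval_zsmul, h1, chEval_add, h2, one_mul]
    exact hspan z hz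
  have hcS : ∀ k : Σ i, {b : {a // a ∈ A i} // b ≠ piv i}, k ∉ Set.range star →
      c k.1 k.2 ∈ algCl S := fun k hk => subset_algCl _ ⟨Sum.inr (Sum.inr ⟨k, hk⟩), rfl⟩
  have hcS' : ∀ k, c (star k).1 (star k).2 ∈ algCl S := by
    intro k
    have hkJ : k.1 ∈ J := (Finset.mem_sdiff.1 k.2).1
    let g : {a // a ∈ A k.1} → ℂ := fun a =>
      c k.1 a * (chEval ξ a.1 * (chEval θ (a.1 - (piv k).1) - 1))
    have hsum : ∑ a, g a = 0 := by
      have h1 := hξ k.1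
      have h2 := hη k.1
      have h3 : ∑ a, g a = (∑ a, c k.1 a * chEval η a.1) / chEval θ (piv k.1).1 -
          ∑ a, c k.1 a * chEval ξ a.1 := by
        rw [Finset.sum_div, ← Finset.sum_sub_distrib]
        refine Finset.sum_congr rfl fun a _ => ?_
        simp only [g, hηθ, chEval_mul, chEval_sub]
        ring
      rw [h3, h1, h2, zero_div, sub_zero]
    rw [Fintype.sum_eq_add_sum_subtype_ne _ (st k)] at hsum
    have hg : ∀ a, a ≠ st k → g a ∈ algCl S := by
      intro a ha
      by_cases hap : a = piv k.1
      · have : g a = 0 := by simp only [g, hap, sub_self, chEval_zero, mul_zero]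
        rw [this]
        exact zero_mem _
      · refine mul_mem (hcS ⟨k.1, a, hap⟩ ?_) (mul_mem (hξS _) (sub_mem (hθS _ ?_) (one_mem _)))
        · rintro ⟨l, hl⟩
          obtain rfl : l = k := Subtype.ext (congr_arg Sigma.fst hl)
          have := eq_of_heq (Sigma.mk.inj hl).2
          exact ha (congr_arg Subtype.val this).symm
        · exact hDL _ hkJ (Submodule.subset_span ⟨a, a.2, _, (piv k.1).2, rfl⟩)
    have hgst : g (st k) ∈ algCl S := by
      rw [eq_neg_of_add_eq_zero_left hsum]
      exact neg_mem (sum_mem fun a _ => hg _ a.2)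
    have hmem : chEval ξ (st k).1 * (chEval θ ((st k).1 - (piv k).1) - 1) ∈ algCl S :=
      mul_mem (hξS _) (sub_mem (hθS _ (hDL _ hkJ
        (Submodule.subset_span ⟨_, (st k).2, _, (piv k.1).2, rfl⟩))) (one_mem _))
    have := div_mem hgst hmem
    rwa [mul_div_cancel_right₀ _
      (mul_ne_zero (chEval_ne_zero _ _) (sub_ne_zero.2 (hst2 k)))] at this
  have hcard := hX.card_le_of_mem_algCl (s := s) (by
    rintro (j | k)
    · exact subset_algCl _ ⟨Sum.inl j, rfl⟩
    · by_cases hk : k ∈ Set.range star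
      · obtain ⟨l, rfl⟩ := hk
        exact hcS' l
      · exact hcS k hk)
  have h1 : Fintype.card {k // k ∉ Set.range star} =
      Fintype.card (Σ i, {b : {a // a ∈ A i} // b ≠ piv i}) - (J \ T).card := by
    rw [Fintype.card_subtype_compl, ← Fintype.card_coe (J \ T)]
    congr 1
    exact Set.card_range_of_injective hinj
  have h2 : (J \ T).card ≤ Fintype.card (Σ i, {b : {a // a ∈ A i} // b ≠ piv i}) := by
    rw [← Fintype.card_coe]
    exact Fintype.card_le_of_injective _ hinj
  have h3 : J.card = Module.finrank ℤ L + 1 := hess.1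
  have h4 := Finset.card_lt_card hTJ
  rw [Finset.card_sdiff_of_subset hTJ.1] at h1 h2
  simp only [Fintype.card_sum, Fintype.card_fin] at hcard
  omega

lemma exists_splitting {r : ℕ} (p : (Fin n → ℤ) →ₗ[ℤ] (Fin r → ℤ)) (hp : Function.Surjective p) :
    ∃ (m : ℕ) (Ψ : (Fin n → ℤ) ≃ₗ[ℤ] (Fin m → ℤ) × (Fin r → ℤ)),
      (∀ x, (Ψ x).2 = p x) ∧ m + r = n := by
  obtain ⟨s, hs⟩ := Module.projective_lifting_property p LinearMap.id hp
  have hs' : ∀ z, p (s z) = z := fun z => LinearMap.congr_fun hs z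
  let e := (Module.finBasis ℤ (LinearMap.ker p)).equivFun
  let f := ((LinearMap.ker p).subtype ∘ₗ e.symm.toLinearMap).coprod s
  have hpf : ∀ x, p (f x) = x.2 := fun x => by
    have h1 : p (e.symm x.1 : Fin n → ℤ) = 0 := (e.symm x.1).2
    simp [f, h1, hs']
  have hf : Function.Bijective f := by
    refine ⟨(injective_iff_map_eq_zero f).2 fun x hx => ?_, fun x => ?_⟩
    · have h2 : x.2 = 0 := by rw [← hpf, hx, map_zero]
      have h1 : ((e.symm x.1 : LinearMap.ker p) : Fin n → ℤ) = 0 := by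
        simpa [f, h2] using hx
      rw [Submodule.coe_eq_zero, LinearEquiv.map_eq_zero_iff] at h1
      exact Prod.ext h1 h2
    · refine ⟨(e ⟨x - s (p x), ?_⟩, p x), ?_⟩
      · rw [LinearMap.mem_ker, map_sub, hs', sub_self]
      · simp [f]
  refine ⟨_, (LinearEquiv.ofBijective f hf).symm, fun x => ?_, ?_⟩
  · rw [← hpf]
    exact congr_arg p ((LinearEquiv.ofBijective f hf).apply_symm_apply x)
  · have := (LinearEquiv.ofBijective f hf).finrank_eq
    simpa using this

section Characters

variable {m : ℕ} (N : Submodule ℤ (Fin m → ℤ)) [Finite ((Fin m → ℤ) ⧸ N)]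

lemma card_chKer_ge :
    Nat.card {ζ : Fin m → ℂˣ // N ≤ chKer ζ} = Nat.card ((Fin m → ℤ) ⧸ N) := by
  have := Fintype.ofFinite ((Fin m → ℤ) ⧸ N)
  have hF : ∀ F : AddChar ((Fin m → ℤ) ⧸ N) ℂ, ∃ ζ : Fin m → ℂˣ, chEval ζ = fun x => F (N.mkQ x) :=
    fun F => exists_chEval_eq _ (by simp) fun x y => by rw [map_add, AddChar.map_add_eq_mul]
  choose g hg using hF
  have hg' : ∀ F, N ≤ chKer (g F) := fun F x hx => by
    have h : N.mkQ x = 0 := (Submodule.Quotient.mk_eq_zero N).2 hx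
    rw [mem_chKer, hg]
    change F (N.mkQ x) = 1
    rw [h, AddChar.map_zero_eq_one]
  have hcard : Nat.card (AddChar ((Fin m → ℤ) ⧸ N) ℂ) = Nat.card ((Fin m → ℤ) ⧸ N) := by
    rw [Nat.card_eq_fintype_card, Nat.card_eq_fintype_card, AddChar.card_eq]
  rw [← hcard]
  refine (Nat.card_eq_of_bijective (fun F => ⟨g F, hg' F⟩) ⟨fun F F' h => ?_, ?_⟩).symm
  · ext z
    obtain ⟨x, rfl⟩ := N.mkQ_surjective z
    have h1 := congr_arg Subtype.val h
    simp only at h1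
    rw [← congr_fun (hg F) x, h1, hg]
  · rintro ⟨ζ, hζ⟩
    have hout : ∀ x, chEval ζ (N.mkQ x).out = chEval ζ x := fun x => by
      have h1 : (N.mkQ x).out - x ∈ N := by
        rw [← Submodule.Quotient.mk_eq_zero, Submodule.Quotient.mk_sub, sub_eq_zero]
        exact Quotient.out_eq (N.mkQ x)
      rw [← sub_add_cancel (N.mkQ x).out x, chEval_add, mem_chKer.1 (hζ h1), one_mul]
    let F : AddChar ((Fin m → ℤ) ⧸ N) ℂ :=
      { toFun := fun z => chEval ζ z.out
        map_zero_eq_one' := by rw [← map_zero N.mkQ, hout, chEval_zero]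
        map_add_eq_mul' := fun z w => by
          obtain ⟨x, rfl⟩ := N.mkQ_surjective z
          obtain ⟨y, rfl⟩ := N.mkQ_surjective w
          rw [← map_add, hout, hout, hout, chEval_add] }
    refine ⟨F, Subtype.ext (chEval_injective ?_)⟩
    rw [hg]
    exact funext hout

lemma finite_chKer_ge : Finite {ζ : Fin m → ℂˣ // N ≤ chKer ζ} :=
  Nat.finite_of_card_ne_zero (by rw [card_chKer_ge]; exact Nat.card_pos.ne')

variable {N} in
lemma exists_pow_chEval_eq_one {ζ : Fin m → ℂˣ} (hζ : N ≤ chKer ζ) (x : Fin m → ℤ) :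
    ∃ k : ℕ, 0 < k ∧ chEval ζ x ^ k = 1 := by
  refine ⟨Nat.card ((Fin m → ℤ) ⧸ N), Nat.card_pos, ?_⟩
  rw [← zpow_natCast, ← chEval_zsmul]
  refine hζ ?_
  rw [← Submodule.Quotient.mk_eq_zero, natCast_zsmul, Submodule.Quotient.mk_smul]
  exact card_nsmul_eq_zero'

end Characters

lemma mixedVolume_reindex {k : ℕ} {ι κ : Type*} [Fintype ι] [Fintype κ] (σ : ι ≃ κ)
    (Q : κ → Set (Fin k → ℝ)) : mixedVolume k (fun i => Q (σ i)) = mixedVolume k Q := by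
  classical
  simp only [mixedVolume, Finset.powerset_univ]
  congr 1
  refine Fintype.sum_equiv σ.finsetCongr _ _ fun s => ?_
  simp [Fintype.card_congr σ]

theorem ncard_sysRoots_of_card_eq {r : ℕ} {ι : Type} [Fintype ι] (hι : Fintype.card ι = r)
    {B : ι → Type} [∀ i, Fintype (B i)] [∀ i, Nonempty (B i)] (a : ∀ i, B i → Fin r → ℤ)
    {c : ∀ i, B i → ℂ} (hc : AlgebraicIndependent ℚ fun p : Σ i, B i => c p.1 p.2) :
    (sysRoots a c).Finite ∧ ((sysRoots a c).ncard : ℝ) =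
      mixedVolume r fun i => convexHull ℝ (Set.range fun b => castR r (a i b)) := by
  let σ := (Fintype.equivFinOfCardEq hι).symm
  have h1 : sysRoots (fun k => a (σ k)) (fun k => c (σ k)) = sysRoots a c :=
    Set.ext fun y => σ.forall_congr_right (q := fun i => ∑ b, c i b * chEval y (a i b) = 0)
  have h2 := ncard_sysRoots (fun k => a (σ k)) (c := fun k => c (σ k))
    (hc.comp (fun p : Σ k, B (σ k) => ⟨σ p.1, p.2⟩) (by
      rintro ⟨k, x⟩ ⟨l, y⟩ h
      obtain rfl : k = l := σ.injective (congr_arg Sigma.fst h)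
      exact congr_arg _ (eq_of_heq (Sigma.mk.inj h).2)))
  rwa [h1, mixedVolume_reindex σ fun i => convexHull ℝ (Set.range fun b => castR r (a i b))] at h2

/-- The number of roots of a generic solvable system, among the points of the torus which
agree with a given root on a lattice, is the index of the lattice in its saturation times a
mixed volume. -/
theorem card_roots_eq_card_mul_mixedVolume {m r : ℕ}
    (Ψ : (Fin n → ℤ) ≃ₗ[ℤ] (Fin m → ℤ) × (Fin r → ℤ)) (hmr : m + r = n) {ι : Type} [Fintype ι]
    (hι : Fintype.card ι = r) {B : ι → Type} [∀ i, Fintype (B i)] (piv : ∀ i, B i)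
    (q : ∀ i, B i → Fin n → ℤ) {c : ∀ i, B i → ℂ} {u : Fin m → ℂˣ} {y : Fin r → ℂˣ}
    (h : torusGlue Ψ u y ∈ sysRoots q c)
    (hX : AlgebraicIndependent ℚ (rootParam piv (torusGlue Ψ u y) c))
    (N : Submodule ℤ (Fin m → ℤ)) [Finite ((Fin m → ℤ) ⧸ N)] :
    (Nat.card {η // η ∈ sysRoots q c ∧
        ∀ x ∈ N, chEval η (Ψ.symm (x, 0)) = chEval (torusGlue Ψ u y) (Ψ.symm (x, 0))} : ℝ) =
      Nat.card ((Fin m → ℤ) ⧸ N) *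
        mixedVolume r fun i => convexHull ℝ (Set.range fun b => castR r (Ψ (q i b)).2) := by
  classical
  have hcard : Fintype.card ι + m = n := by omega
  have hne : ∀ i, Nonempty (B i) := fun i => ⟨piv i⟩
  by_cases hred : AlgebraicIndependent ℚ (redParam Ψ q c u)
  · have hfib : ∀ ζ : {ζ : Fin m → ℂˣ // N ≤ chKer ζ},
        (sysRoots (fun i b => (Ψ (q i b)).2) (redCoeff Ψ q c (ζ.1 * u))).Finite ∧
        ((sysRoots (fun i b => (Ψ (q i b)).2) (redCoeff Ψ q c (ζ.1 * u))).ncard : ℝ) =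
          mixedVolume r fun i => convexHull ℝ (Set.range fun b => castR r (Ψ (q i b)).2) :=
      fun ζ => ncard_sysRoots_of_card_eq hι _
        (algebraicIndependent_redCoeff_mul hred fun x => exists_pow_chEval_eq_one ζ.2 x)
    have hfin : ∀ ζ : {ζ : Fin m → ℂˣ // N ≤ chKer ζ},
        Finite (sysRoots (fun i b => (Ψ (q i b)).2) (redCoeff Ψ q c (ζ.1 * u))) :=
      fun ζ => (hfib ζ).1
    have := finite_chKer_ge N
    have := Fintype.ofFinite {ζ : Fin m → ℂˣ // N ≤ chKer ζ}
    rw [← card_chKer_ge N]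
    have hbij : Nat.card (Σ ζ : {ζ : Fin m → ℂˣ // N ≤ chKer ζ},
        sysRoots (fun i b => (Ψ (q i b)).2) (redCoeff Ψ q c (ζ.1 * u))) =
        Nat.card {η // η ∈ sysRoots q c ∧
          ∀ x ∈ N, chEval η (Ψ.symm (x, 0)) = chEval (torusGlue Ψ u y) (Ψ.symm (x, 0))} := by
      refine Nat.card_eq_of_bijective (fun w => ⟨torusGlue Ψ (w.1.1 * u) w.2.1,
        (torusGlue_mem_sysRoots Ψ q c).2 w.2.2, fun x hx => ?_⟩) ⟨?_, ?_⟩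
      · rw [chEval_torusGlue_inl, chEval_torusGlue_inl, chEval_mul, mem_chKer.1 (w.1.2 hx),
          one_mul]
      · rintro ⟨⟨ζ, hζ⟩, ⟨z, hz⟩⟩ ⟨⟨ζ', hζ'⟩, ⟨z', hz'⟩⟩ hw
        have h1 := congr_arg Subtype.val hw
        simp only [torusGlue_inj, mul_left_inj] at h1
        obtain ⟨rfl, rfl⟩ := h1
        rfl
      · rintro ⟨η, hη, hηN⟩
        obtain ⟨v, z, rfl⟩ := exists_torusGlue_eq Ψ η
        have hv : N ≤ chKer (v * u⁻¹) := fun x hx => by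
          have h1 := hηN x hx
          rw [chEval_torusGlue_inl, chEval_torusGlue_inl] at h1
          have h2 : chEval (v * u⁻¹) x * chEval u x = chEval u x := by
            rw [← chEval_mul, inv_mul_cancel_right, h1]
          exact mul_eq_right₀ (chEval_ne_zero u x) |>.1 h2
        refine ⟨⟨⟨v * u⁻¹, hv⟩, ⟨z, ?_⟩⟩, Subtype.ext ?_⟩
        · simp only [inv_mul_cancel_right]
          exact (torusGlue_mem_sysRoots Ψ q c).1 hη
        · simp only [inv_mul_cancel_right]
    rw [← hbij, Nat.card_sigma, Nat.cast_sum]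
    simp only [Nat.card_coe_set_eq, (hfib _).2, Finset.sum_const, Finset.card_univ, nsmul_eq_mul,
      Nat.card_eq_fintype_card]
  · obtain ⟨e, he⟩ := exists_algebraicIndependent ((Σ i, B i) ⊕ Fin m)
    have hempty : sysRoots (fun i b => (Ψ (q i b)).2) (fun i b => e (Sum.inl ⟨i, b⟩)) = ∅ := by
      by_contra hcon
      refine hred (algebraicIndependent_redParam piv hcard h hX (e := fun i b => e (Sum.inl ⟨i, b⟩))
        (v := fun t => e (Sum.inr t)) ?_ (Set.nonempty_iff_ne_empty.2 hcon))
      convert he using 1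
      ext k
      rcases k with k | t <;> rfl
    have hMV := (ncard_sysRoots_of_card_eq hι (fun i b => (Ψ (q i b)).2)
      (c := fun i b => e (Sum.inl ⟨i, b⟩)) (he.comp Sum.inl Sum.inl_injective)).2
    rw [hempty, Set.ncard_empty, Nat.cast_zero] at hMV
    rw [← hMV, mul_zero, Nat.cast_eq_zero]
    have hinf := exists_infinite_torusAut piv hcard hX hred
    refine Nat.card_eq_zero.2 (Or.inr (Set.infinite_coe_iff.2 (hinf.mono ?_)))
    rintro _ ⟨φ, hφc, hφu, rfl⟩
    refine ⟨torusAut_mem_sysRoots q φ hφc h, fun x _ => ?_⟩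
    rw [torusAut_torusGlue, hφu, chEval_torusGlue_inl, chEval_torusGlue_inl]

lemma isRootOf_iff {A : Fin (n + 1) → Finset (Fin n → ℤ)} {c : Fin (n + 1) → (Fin n → ℤ) → ℂ}
    {ξ : Fin n → ℂˣ} :
    IsRootOf A c ξ ↔ ξ ∈ sysRoots (fun i (b : {a // a ∈ A i}) => b.1) fun i b => c i b.1 :=
  forall_congr' fun i => by rw [← Finset.sum_coe_sort]

section Param

variable {κ : Type} {A : κ → Finset (Fin n → ℤ)} (piv : ∀ i, {a // a ∈ A i})

open Classical in
/-- The coefficients of a system with a prescribed root and prescribed non-pivot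
coefficients, agreeing with `c₀` off the supports. -/
def coeffOfParam (c₀ : κ → (Fin n → ℤ) → ℂ)
    (x : Fin n ⊕ (Σ i, {b : {a // a ∈ A i} // b ≠ piv i}) → ℂ) (i : κ) (a : Fin n → ℤ) : ℂ :=
  if h : a ∈ A i then
    if h' : (⟨a, h⟩ : {a // a ∈ A i}) = piv i then
      -(∑ k : {b : {a // a ∈ A i} // b ≠ piv i},
        x (Sum.inr ⟨i, k⟩) * ∏ j, x (Sum.inl j) ^ (k.1.1 j)) / ∏ j, x (Sum.inl j) ^ (a j)
    else x (Sum.inr ⟨i, ⟨a, h⟩, h'⟩)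
  else c₀ i a

variable {piv}

lemma coeffOfParam_rootParam {c₀ : κ → (Fin n → ℤ) → ℂ} {ξ : Fin n → ℂˣ}
    (h : ξ ∈ sysRoots (fun i (b : {a // a ∈ A i}) => b.1) fun i b => c₀ i b.1) :
    coeffOfParam piv c₀ (rootParam piv ξ fun i b => c₀ i b.1) = c₀ := by
  classical
  ext i a
  unfold coeffOfParam
  split_ifs with h1 h2
  · have := sysRoots_pivot h i (piv i)
    rw [← h2] at this
    rw [this]
    simp only [rootParam, Sum.elim_inl, Sum.elim_inr, chEval, Units.val_zpow_eq_zpow_val]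
    congr 2
    rw [h2]
  · rfl
  · rfl

lemma mem_sysRoots_coeffOfParam (c₀ : κ → (Fin n → ℤ) → ℂ)
    {x : Fin n ⊕ (Σ i, {b : {a // a ∈ A i} // b ≠ piv i}) → ℂ} {ξ : Fin n → ℂˣ}
    (hξ : ∀ j, (ξ j : ℂ) = x (Sum.inl j)) :
    ξ ∈ sysRoots (fun i (b : {a // a ∈ A i}) => b.1) fun i b => coeffOfParam piv c₀ x i b.1 := by
  classical
  intro i
  have hch : ∀ a, chEval ξ a = ∏ j, x (Sum.inl j) ^ (a j) := fun a => by
    simp only [chEval, Units.val_zpow_eq_zpow_val, hξ]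
  rw [Fintype.sum_eq_add_sum_subtype_ne _ (piv i)]
  have h1 : coeffOfParam piv c₀ x i (piv i).1 * chEval ξ (piv i).1 =
      -∑ k : {b : {a // a ∈ A i} // b ≠ piv i}, x (Sum.inr ⟨i, k⟩) * chEval ξ k.1.1 := by
    simp only [coeffOfParam, dif_pos (piv i).2, ← hch, dite_true]
    rw [div_mul_cancel₀ _ (chEval_ne_zero _ _)]
  rw [h1, neg_add_eq_zero]
  refine Finset.sum_congr rfl fun k _ => ?_
  simp only [coeffOfParam, dif_pos k.1.2, Subtype.coe_eta, dif_neg k.2]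

lemma rootParam_coeffOfParam (c₀ : κ → (Fin n → ℤ) → ℂ)
    {x : Fin n ⊕ (Σ i, {b : {a // a ∈ A i} // b ≠ piv i}) → ℂ} {ξ : Fin n → ℂˣ}
    (hξ : ∀ j, (ξ j : ℂ) = x (Sum.inl j)) :
    rootParam piv ξ (fun i b => coeffOfParam piv c₀ x i b.1) = x := by
  ext k
  rcases k with j | ⟨i, k⟩
  · exact hξ j
  · change coeffOfParam piv c₀ x i k.1.1 = _
    rw [coeffOfParam, dif_pos k.1.2, dif_neg k.2]

lemma continuousAt_coeffOfParam (c₀ : κ → (Fin n → ℤ) → ℂ)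
    {x : Fin n ⊕ (Σ i, {b : {a // a ∈ A i} // b ≠ piv i}) → ℂ} (hx : ∀ j, x (Sum.inl j) ≠ 0) :
    ContinuousAt (coeffOfParam piv c₀) x := by
  have hmon : ∀ a : Fin n → ℤ, ContinuousAt
      (fun x : Fin n ⊕ (Σ i, {b : {a // a ∈ A i} // b ≠ piv i}) → ℂ =>
        ∏ j, x (Sum.inl j) ^ (a j)) x := fun a =>
    tendsto_finsetProd _ fun j _ =>
      (continuous_apply (Sum.inl j)).continuousAt.zpow₀ _ (Or.inl (hx j))
  refine continuousAt_pi.2 fun i => continuousAt_pi.2 fun a => ?_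
  unfold coeffOfParam
  split_ifs with h1 h2
  · refine ContinuousAt.div (ContinuousAt.neg (tendsto_finsetSum _ fun k _ => ?_)) (hmon a)
      (Finset.prod_ne_zero_iff.2 fun j _ => zpow_ne_zero _ (hx j))
    exact (continuous_apply _).continuousAt.mul (hmon _)
  · exact (continuous_apply _).continuousAt
  · exact continuousAt_const

/-- Near a solvable system there is a generic one. -/
lemma exists_algebraicIndependent_rootParam [Fintype κ] {U : Set (κ → (Fin n → ℤ) → ℂ)}
    (hU : IsOpen U) {c₀ : κ → (Fin n → ℤ) → ℂ} (hc₀ : c₀ ∈ U) {ξ₀ : Fin n → ℂˣ}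
    (h : ξ₀ ∈ sysRoots (fun i (b : {a // a ∈ A i}) => b.1) fun i b => c₀ i b.1) :
    ∃ c ∈ U, ∃ ξ ∈ sysRoots (fun i (b : {a // a ∈ A i}) => b.1) fun i b => c i b.1,
      AlgebraicIndependent ℚ (rootParam piv ξ fun i b => c i b.1) := by
  classical
  have hcont := continuousAt_coeffOfParam (piv := piv) c₀
    (x := rootParam piv ξ₀ fun i b => c₀ i b.1) fun j => (ξ₀ j).ne_zero
  have hU' : U ∈ nhds (coeffOfParam piv c₀ (rootParam piv ξ₀ fun i b => c₀ i b.1)) := by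
    rw [coeffOfParam_rootParam h]
    exact hU.mem_nhds hc₀
  obtain ⟨x, hx, hxU⟩ := (Measure.dense_of_ae (ae_algebraicIndependent
    (Fin n ⊕ (Σ i, {b : {a // a ∈ A i} // b ≠ piv i})))).inter_nhds_nonempty
      (hcont.preimage_mem_nhds hU')
  let ξ : Fin n → ℂˣ := fun j => Units.mk0 (x (Sum.inl j)) (AlgebraicIndependent.ne_zero hx _)
  refine ⟨_, hxU, ξ, mem_sysRoots_coeffOfParam c₀ fun _ => rfl, ?_⟩
  rw [rootParam_coeffOfParam c₀ fun _ => rfl]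
  exact hx

end Param

lemma le_of_saturation {M : Type*} [AddCommGroup M] {L L' : Submodule ℤ M}
    (h : ∀ x, x ∈ L' ↔ ∃ k : ℤ, k ≠ 0 ∧ k • x ∈ L) : L ≤ L' :=
  fun x hx => (h x).2 ⟨1, one_ne_zero, by rwa [one_smul]⟩

lemma isTorsion_saturation_quotient {M : Type*} [AddCommGroup M] {L L' : Submodule ℤ M}
    (h : ∀ x, x ∈ L' ↔ ∃ k : ℤ, k ≠ 0 ∧ k • x ∈ L) :
    Module.IsTorsion ℤ (L' ⧸ L.comap L'.subtype) := by
  intro z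
  obtain ⟨⟨x, hx⟩, rfl⟩ := Submodule.Quotient.mk_surjective _ z
  obtain ⟨k, hk, hkx⟩ := (h x).1 hx
  refine ⟨⟨k, mem_nonZeroDivisors_of_ne_zero hk⟩, ?_⟩
  rw [Submonoid.mk_smul, ← Submodule.Quotient.mk_smul, Submodule.Quotient.mk_eq_zero]
  exact hkx

lemma finrank_saturation {L L' : Submodule ℤ (Fin n → ℤ)}
    (h : ∀ x, x ∈ L' ↔ ∃ k : ℤ, k ≠ 0 ∧ k • x ∈ L) :
    Module.finrank ℤ L = Module.finrank ℤ L' := by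
  rw [← Submodule.finrank_quotient_add_finrank (L.comap L'.subtype),
    Module.finrank_eq_zero_iff_isTorsion.2 (isTorsion_saturation_quotient h), zero_add,
    finrank_comap_subtype (le_of_saturation h)]

/-- The kernel of the second component of a splitting is identified with the first summand. -/
def splittingKer {m r : ℕ} (Ψ : (Fin n → ℤ) ≃ₗ[ℤ] (Fin m → ℤ) × (Fin r → ℤ))
    {L' : Submodule ℤ (Fin n → ℤ)} (h : ∀ x, x ∈ L' ↔ (Ψ x).2 = 0) : (Fin m → ℤ) ≃ₗ[ℤ] L' :=
  LinearEquiv.ofBijective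
    ((Ψ.symm.toLinearMap ∘ₗ LinearMap.inl ℤ _ _).codRestrict L' fun x => (h _).2 (by simp)) <| by
    refine ⟨fun x y hxy => ?_, fun ⟨z, hz⟩ => ⟨(Ψ z).1, Subtype.ext ?_⟩⟩
    · have h1 : Ψ.symm (x, 0) = Ψ.symm (y, 0) := congr_arg Subtype.val hxy
      exact congr_arg Prod.fst (Ψ.symm.injective h1)
    · change Ψ.symm ((Ψ z).1, 0) = z
      rw [← (h z).1 hz, Prod.mk.eta, Ψ.symm_apply_apply]

lemma coe_splittingKer {m r : ℕ} (Ψ : (Fin n → ℤ) ≃ₗ[ℤ] (Fin m → ℤ) × (Fin r → ℤ))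
    {L' : Submodule ℤ (Fin n → ℤ)} (h : ∀ x, x ∈ L' ↔ (Ψ x).2 = 0) (x : Fin m → ℤ) :
    (splittingKer Ψ h x : Fin n → ℤ) = Ψ.symm (x, 0) := rfl

lemma mem_sysRoots_iff {κ : Type} [Fintype κ] {A : κ → Finset (Fin n → ℤ)} {J : Finset κ}
    (hess : IsEssential A J) (piv : ∀ i, {a // a ∈ A i}) {c : ∀ i, {a // a ∈ A i} → ℂ}
    {ξ η : Fin n → ℂˣ} (hξ : ξ ∈ sysRoots (fun i (b : {a // a ∈ A i}) => b.1) c)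
    (hX : AlgebraicIndependent ℚ (rootParam piv ξ c)) :
    η ∈ sysRoots (fun i (b : {a // a ∈ A i}) => b.1) c ↔
      η ∈ sysRoots (fun (i : {i // i ∉ J}) (b : {a // a ∈ A i.1}) => b.1) (fun i => c i.1) ∧
        ∑ j ∈ J, diffLattice (A j) ≤ chKer (ξ⁻¹ * η) := by
  refine ⟨fun hη => ⟨fun i => hη i.1, lattice_le_chKer hess piv hξ hη hX⟩, ?_⟩
  rintro ⟨h1, h2⟩ i
  by_cases hi : i ∈ J
  · have h3 := (diffLattice_le_iff (piv i).2).1 ((Submodule.finset_sum_le_iff _ _ _).1 h2 i hi)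
    have h4 : ∀ b : {a // a ∈ A i},
        chEval η b.1 = chEval (ξ⁻¹ * η) (piv i).1 * chEval ξ b.1 := fun b => by
      have h5 := mem_chKer.1 (h3 b.1 b.2)
      rw [chEval_sub, div_eq_one_iff_eq (chEval_ne_zero _ _)] at h5
      rw [← h5, mul_comm, ← chEval_mul, mul_inv_cancel_left]
    simp_rw [h4, mul_left_comm _ (chEval (ξ⁻¹ * η) (piv i).1), ← Finset.mul_sum]
    rw [hξ i, mul_zero]
  · exact h1 ⟨i, hi⟩

lemma le_chKer_iff {ξ η : Fin n → ℂˣ} {L : Submodule ℤ (Fin n → ℤ)} :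
    L ≤ chKer (ξ⁻¹ * η) ↔ ∀ x ∈ L, chEval η x = chEval ξ x := by
  refine forall₂_congr fun x _ => ?_
  rw [mem_chKer, ← mul_right_inj' (chEval_ne_zero ξ x), ← chEval_mul, mul_inv_cancel_left, mul_one]

/-- The number of common roots of a generic solvable system. -/
theorem card_sysRoots_eq {κ : Type} [Fintype κ] {A : κ → Finset (Fin n → ℤ)}
    (hκ : Fintype.card κ = n + 1) {J : Finset κ} (hess : IsEssential A J)
    (piv : ∀ i, {a // a ∈ A i}) {c : ∀ i, {a // a ∈ A i} → ℂ} {ξ : Fin n → ℂˣ}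
    (hξ : ξ ∈ sysRoots (fun i (b : {a // a ∈ A i}) => b.1) c)
    (hX : AlgebraicIndependent ℚ (rootParam piv ξ c)) {L' : Submodule ℤ (Fin n → ℤ)}
    (hL' : ∀ x, x ∈ L' ↔ ∃ k : ℤ, k ≠ 0 ∧ k • x ∈ ∑ j ∈ J, diffLattice (A j))
    {r : ℕ} {p : (Fin n → ℤ) →ₗ[ℤ] (Fin r → ℤ)} (hp : Function.Surjective p)
    (hker : LinearMap.ker p = L') [Fintype {i // i ∉ J}] :
    (Nat.card {η // η ∈ sysRoots (fun i (b : {a // a ∈ A i}) => b.1) c} : ℝ) =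
      Nat.card (L' ⧸ (∑ j ∈ J, diffLattice (A j)).comap L'.subtype) *
        mixedVolume r fun i : {i // i ∉ J} =>
          convexHull ℝ (Set.range fun b : {a // a ∈ A i.1} => castR r (p b.1)) := by
  classical
  obtain ⟨m, Ψ, hΨ, hmr⟩ := exists_splitting p hp
  obtain ⟨u, y, rfl⟩ := exists_torusGlue_eq Ψ ξ
  set L := ∑ j ∈ J, diffLattice (A j) with hL
  have hmem : ∀ x, x ∈ L' ↔ (Ψ x).2 = 0 := fun x => by rw [← hker, LinearMap.mem_ker, hΨ]
  let e := splittingKer Ψ hmem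
  have hι : Fintype.card {i // i ∉ J} = r := by
    have h1 := hess.1
    rw [← hL, finrank_saturation hL', ← e.finrank_eq, Module.finrank_fin_fun] at h1
    rw [Fintype.card_subtype_compl, Fintype.card_coe]
    omega
  let N : Submodule ℤ (Fin m → ℤ) := (L.comap L'.subtype).comap e.toLinearMap
  let eq : ((Fin m → ℤ) ⧸ N) ≃ₗ[ℤ] L' ⧸ L.comap L'.subtype :=
    Submodule.Quotient.equiv N _ e (Submodule.map_comap_eq_of_surjective e.surjective _)
  have : Finite (L' ⧸ L.comap L'.subtype) :=
    Module.finite_of_fg_torsion _ (isTorsion_saturation_quotient hL')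
  have : Finite ((Fin m → ℤ) ⧸ N) := Finite.of_equiv _ eq.toEquiv.symm
  let ρ : Fin n ⊕ (Σ i : {i // i ∉ J}, {b : {a // a ∈ A i.1} // b ≠ piv i.1}) →
      Fin n ⊕ (Σ i, {b : {a // a ∈ A i} // b ≠ piv i}) :=
    Sum.map id fun k => ⟨k.1.1, k.2⟩
  have hρ : Function.Injective ρ := by
    refine Function.injective_id.sumMap ?_
    rintro ⟨⟨i, hi⟩, k⟩ ⟨⟨j, hj⟩, l⟩ h
    obtain ⟨rfl, h⟩ := Sigma.mk.inj_iff.1 h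
    exact congr_arg (Sigma.mk _) (eq_of_heq h)
  have hX' : AlgebraicIndependent ℚ (rootParam (fun i : {i // i ∉ J} => piv i.1)
      (torusGlue Ψ u y) fun i => c i.1) := by
    convert hX.comp ρ hρ using 1
    ext k
    rcases k with j | k <;> rfl
  have key := card_roots_eq_card_mul_mixedVolume Ψ hmr hι (fun i => piv i.1)
    (fun (i : {i // i ∉ J}) (b : {a // a ∈ A i.1}) => b.1) (fun i => hξ i.1) hX' N
  rw [Nat.card_congr eq.toEquiv] at key
  simp only [hΨ] at key
  rw [← key]
  congr 1
  refine Nat.card_congr (Equiv.subtypeEquivRight fun η => ?_)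
  rw [mem_sysRoots_iff hess piv hξ hX, le_chKer_iff]
  refine and_congr_right fun _ => ⟨fun h x hx => h _ hx, fun h x hx => ?_⟩
  have h1 := h (e.symm ⟨x, le_of_saturation hL' hx⟩)
    (show (e (e.symm _) : Fin n → ℤ) ∈ L by rwa [e.apply_symm_apply])
  rwa [← coe_splittingKer Ψ hmem, show splittingKer Ψ hmem (e.symm _) = _ from
    e.apply_symm_apply _] at h1

/-- Suppose the family `A_0, …, A_n` of nonempty finite subsets of
`ℤ^n` has a unique essential subfamily, indexed by `J` (equivalently, the sparse
resultant is nontrivial).  Let `L = L_J` be the associated lattice, `L^sat` its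
saturation, and identify `M/L^sat` with `ℤ^r` via a surjection `p` with kernel `L^sat`
(with real extension `pR`).  Then `Res = ± Elim^d` with
`d = [L^sat : L] ⬝ MV_{M/L^sat}({π(Δ_i)}_{i ∉ J})`. -/
theorem resultant_eq_eliminant_pow
    (A : Fin (n + 1) → Finset (Fin n → ℤ)) (hA : ∀ i, (A i).Nonempty)
    (J : Finset (Fin (n + 1)))
    (hess : IsEssential A J ∧ ∀ J' : Finset (Fin (n + 1)), IsEssential A J' → J' = J)
    (Lsat : Submodule ℤ (Fin n → ℤ))
    (hLsat : ∀ x, x ∈ Lsat ↔ ∃ k : ℤ, k ≠ 0 ∧ k • x ∈ ∑ j ∈ J, diffLattice (A j))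
    (r : ℕ) (p : (Fin n → ℤ) →ₗ[ℤ] (Fin r → ℤ)) (hpsurj : Function.Surjective p)
    (hpker : LinearMap.ker p = Lsat)
    (pR : (Fin n → ℝ) →ₗ[ℝ] (Fin r → ℝ))
    (hpR : ∀ x : Fin n → ℤ, pR (castR n x) = castR r (p x))
    (R : MvPolynomial (Fin (n + 1) × (Fin n → ℤ)) ℤ) (hR : IsResultant A R) :
    ∃ E, IsEliminant A E ∧ ∃ d : ℕ, (R = E ^ d ∨ R = -E ^ d) ∧
      (d : ℝ) =
        (Nat.card (↥Lsat ⧸ Submodule.comap Lsat.subtype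
            (∑ j ∈ J, diffLattice (A j))) : ℝ) *
          mixedVolume r (fun i : {i : Fin (n + 1) // i ∉ J} =>
            pR '' convexHull ℝ (castR n '' ↑(A i.1))) := by
  obtain ⟨E, d, hE, hd, U, hU, hcl, hcard⟩ := hR
  refine ⟨E, hE, d, hd, ?_⟩
  obtain ⟨c₀, hc₀U, ξ₀, hξ₀⟩ : (U ∩ {c | HasRoot A c}).Nonempty := by
    rw [← closure_nonempty_iff, hcl, closure_nonempty_iff]
    exact ⟨0, 1, fun i => by simp⟩
  let piv : ∀ i, {a // a ∈ A i} := fun i => ⟨(hA i).choose, (hA i).choose_spec⟩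
  obtain ⟨c, hcU, ξ, hξ, hX⟩ := exists_algebraicIndependent_rootParam (piv := piv) hU hc₀U
    (isRootOf_iff.1 hξ₀)
  rw [← hcard c ⟨hcU, ξ, isRootOf_iff.2 hξ⟩,
    Nat.card_congr (Equiv.subtypeEquivRight fun η => isRootOf_iff (A := A) (c := c) (ξ := η)),
    card_sysRoots_eq (Fintype.card_fin _) hess.1 piv hξ hX hLsat hpsurj hpker]
  congr 2 with i : 1
  rw [LinearMap.image_convexHull, Set.image_image]
  simp only [hpR]
  rw [Set.image_eq_range]
  rfl

end
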